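/- arXiv:0706.2778 — 2 statements merged into one kernel-verified Lean document; each statement's English description precedes it below -/
import Mathlib

section
/- Let (W,S) be a finite irreducible Coxeter system of rank n with Coxeter number h, and let (j₁,…,j_{k+1}) be a sequence of nonnegative integers with j₁+⋯+j_{k+1} = n such that j_i = 1 for some fixed index i. Then 2·C_{(j₁,…,j_{k+1})}(W) = h · ∑_{s∈S} C_{(j₁,…,ĵ_i,…,j_{k+1})}(W_⟨s⟩), where the hat denotes deletion of the i-th entry (so the sequence on the right sums to n−1, the rank of W_⟨s⟩). -/
open scoped BigOperators

section Defs

variable {G : Type*} [Group G]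

/-- `t` is a reflection with respect to the generating set `S`:
a conjugate of an element of `S`. -/
def IsReflectionOf (S : Set G) (t : G) : Prop :=
  ∃ g : G, ∃ s ∈ S, t = g * s * g⁻¹

/-- The absolute length of `w`: the minimal length of a word in the
reflections (conjugates of elements of `S`) whose product is `w`. -/
noncomputable def absLength (S : Set G) (w : G) : ℕ :=
  sInf {k | ∃ l : List G, (∀ t ∈ l, IsReflectionOf S t) ∧ l.length = k ∧ l.prod = w}

/-- The absolute order: `u ≤ v` iff `ℓ_T(u) + ℓ_T(u⁻¹v) = ℓ_T(v)`. -/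
def absLe (S : Set G) (u v : G) : Prop :=
  absLength S u + absLength S (u⁻¹ * v) = absLength S v

/-- `c` is a Coxeter element with respect to the set `S` of simple reflections:
a product of all the elements of `S`, each occurring exactly once, in some order. -/
def IsCoxeterElementOf (S : Set G) (c : G) : Prop :=
  ∃ l : List G, l.Nodup ∧ (∀ x, x ∈ l ↔ x ∈ S) ∧ l.prod = c

/-- The rank-selected multichain count `C_{(j₁,…,j_m)}(W)`: the number of multichains
`x₁ ≤ ⋯ ≤ x_{m-1}` in the interval `[1,c]` of the absolute order whose sequence of
rank jumps (prepending `1` and appending `c`) is given by `j`. -/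
noncomputable def chainCount (S : Set G) (c : G) {m : ℕ} (j : Fin m → ℕ) : ℕ :=
  Nat.card {y : Fin (m + 1) → G //
    y 0 = 1 ∧ y (Fin.last m) = c ∧
    (∀ i, absLe S (y i) c) ∧
    (∀ i : Fin m, absLe S (y i.castSucc) (y i.succ)) ∧
    (∀ i : Fin m, absLength S (y i.succ) = absLength S (y i.castSucc) + j i)}

end Defs

section Cox

variable {B : Type*} {W : Type*} [Group W] {M : CoxeterMatrix B}

/-- The set of simple reflections of a Coxeter system. -/
def simpleSet (cs : CoxeterSystem M W) : Set W := Set.range cs.simple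

/-- A Coxeter system is irreducible if its set of simple reflections is nonempty and cannot
be partitioned into two nonempty subsets such that every simple reflection in one commutes
with every simple reflection in the other. -/
def IsIrreducibleCS (cs : CoxeterSystem M W) : Prop :=
  Nonempty B ∧
    ∀ A : Set B, (∀ a ∈ A, ∀ b ∈ Aᶜ, Commute (cs.simple a) (cs.simple b)) →
      A = ∅ ∨ A = Set.univ

/-- The standard parabolic subgroup `W_⟨s⟩` generated by the simple reflections
other than `cs.simple s`. -/
def parabolic (cs : CoxeterSystem M W) (s : B) : Subgroup W :=
  Subgroup.closure (Set.range cs.simple \ {cs.simple s})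

/-- The set of simple reflections of the parabolic subgroup `W_⟨s⟩`, viewed as
elements of that subgroup. -/
def parabolicGens (cs : CoxeterSystem M W) (s : B) : Set (parabolic cs s) :=
  {x | (x : W) ∈ Set.range cs.simple \ {cs.simple s}}

end Cox

namespace CoxeterGeometry

section

open Module

variable {B W : Type*} [Fintype B] [DecidableEq B] [Group W] {M : CoxeterMatrix B}

/-- The Cartan-type matrix `-2 cos (π / M s t)` of a Coxeter matrix. -/
noncomputable def cartan (M : CoxeterMatrix B) (s t : B) : ℝ := -2 * Real.cos (Real.pi / M s t)

/-- The simple root `α_s`, a standard basis vector. -/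
def simpleRoot (s : B) : B → ℝ := Pi.single s 1

/-- The simple coroot: the functional `x ↦ 2 (α_s, x)`. -/
noncomputable def coroot (M : CoxeterMatrix B) (s : B) : (B → ℝ) →ₗ[ℝ] ℝ :=
  ∑ r, cartan M s r • LinearMap.proj r

/-- The simple reflection in the geometric representation. -/
noncomputable def sigma (M : CoxeterMatrix B) (s : B) : End ℝ (B → ℝ) :=
  LinearMap.id - (coroot M s).smulRight (simpleRoot s)

/-- The invariant symmetric bilinear form with Gram matrix `cartan M`. -/
noncomputable def form (M : CoxeterMatrix B) : (B → ℝ) →ₗ[ℝ] (B → ℝ) →ₗ[ℝ] ℝ :=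
  ∑ s, (LinearMap.proj (R := ℝ) (φ := fun _ : B => ℝ) s).smulRight (coroot M s)

omit [Fintype B] in
@[simp] lemma simpleRoot_self (s : B) : simpleRoot s s = 1 := by simp [simpleRoot]

omit [Fintype B] in
lemma simpleRoot_of_ne {s t : B} (h : t ≠ s) : simpleRoot s t = 0 := by simp [simpleRoot, h]

omit [Fintype B] [DecidableEq B] in
lemma cartan_comm (s t : B) : cartan M s t = cartan M t s := by
  simp [cartan, M.symmetric s t]

omit [Fintype B] [DecidableEq B] in
@[simp] lemma cartan_self (s : B) : cartan M s s = 2 := by simp [cartan]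

omit [Fintype B] [DecidableEq B] in
lemma cartan_of_eq_two {s t : B} (h : M s t = 2) : cartan M s t = 0 := by simp [cartan, h]

omit [Fintype B] [DecidableEq B] in
lemma cartan_le_neg_one {s t : B} (hst : s ≠ t) (h : M s t ≠ 2) : cartan M s t ≤ -1 := by
  have h1 := M.off_diagonal s t hst
  have key : Real.cos (Real.pi / 3) ≤ Real.cos (Real.pi / M s t) := by
    rcases Nat.eq_zero_or_pos (M s t) with h0 | h0
    · simp [h0]
      norm_num
    · have h3 : (3 : ℝ) ≤ M s t := by exact_mod_cast (show 3 ≤ M s t by omega)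
      apply Real.cos_le_cos_of_nonneg_of_le_pi
      · positivity
      · linarith [Real.pi_pos]
      · exact div_le_div_of_nonneg_left Real.pi_pos.le (by norm_num) h3
  rw [Real.cos_pi_div_three] at key
  unfold cartan
  linarith

omit [Fintype B] [DecidableEq B] in
lemma cartan_nonpos {s t : B} (hst : s ≠ t) : cartan M s t ≤ 0 := by
  by_cases h : M s t = 2
  · exact (cartan_of_eq_two h).le
  · linarith [cartan_le_neg_one hst h]

omit [DecidableEq B] in
lemma coroot_apply (s : B) (x : B → ℝ) : coroot M s x = ∑ r, cartan M s r * x r := by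
  simp [coroot]

@[simp] lemma coroot_simpleRoot (s t : B) : coroot M s (simpleRoot t) = cartan M s t := by
  simp [coroot_apply, simpleRoot, Pi.single_apply]

lemma sigma_apply (s : B) (x : B → ℝ) : sigma M s x = x - coroot M s x • simpleRoot s := by
  simp [sigma]

lemma sigma_apply_of_ne {s t : B} (h : t ≠ s) (x : B → ℝ) : sigma M s x t = x t := by
  simp [sigma_apply, simpleRoot_of_ne h]

omit [DecidableEq B] in
lemma form_apply (x y : B → ℝ) : form M x y = ∑ s, x s * coroot M s y := by
  simp [form]

@[simp] lemma form_simpleRoot_left (s : B) (y : B → ℝ) :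
    form M (simpleRoot s) y = coroot M s y := by
  simp [form_apply, simpleRoot, Pi.single_apply]

omit [DecidableEq B] in
lemma form_comm (x y : B → ℝ) : form M x y = form M y x := by
  simp only [form_apply, coroot_apply, Finset.mul_sum]
  rw [Finset.sum_comm]
  refine Finset.sum_congr rfl fun s _ => Finset.sum_congr rfl fun t _ => ?_
  rw [cartan_comm]; ring

@[simp] lemma form_simpleRoot_right (s : B) (y : B → ℝ) :
    form M y (simpleRoot s) = coroot M s y := by
  rw [form_comm, form_simpleRoot_left]

lemma form_sigma (s : B) (x y : B → ℝ) : form M (sigma M s x) (sigma M s y) = form M x y := by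
  simp [sigma_apply]
  ring

lemma sigma_sigma (s : B) (x : B → ℝ) : sigma M s (sigma M s x) = x := by
  simp [sigma_apply]
  module

lemma sigma_mul_pow_simpleRoot {s t : B} {θ : ℝ} (h : cartan M s t = -2 * Real.cos θ) (k : ℕ) :
    Real.sin θ • ((sigma M s * sigma M t) ^ k) (simpleRoot s) =
      Real.sin ((2 * k + 1) * θ) • simpleRoot s + Real.sin (2 * k * θ) • simpleRoot t ∧
    Real.sin θ • ((sigma M s * sigma M t) ^ k) (simpleRoot t) =
      -(Real.sin (2 * k * θ) • simpleRoot s + Real.sin ((2 * k - 1) * θ) • simpleRoot t) := by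
  have hrec (x : ℝ) : Real.sin (x + θ) = 2 * Real.cos θ * Real.sin x - Real.sin (x - θ) := by
    rw [Real.sin_add, Real.sin_sub]; ring
  have ht : cartan M t s = -2 * Real.cos θ := by rw [cartan_comm, h]
  induction k with
  | zero => simp [Real.sin_neg]
  | succ k ih =>
    have e1 : Real.sin ((2 * ((k + 1 : ℕ) : ℝ) + 1) * θ) =
        2 * Real.cos θ * Real.sin (2 * (k + 1 : ℕ) * θ) - Real.sin ((2 * k + 1) * θ) := by
      rw [show (2 * ((k + 1 : ℕ) : ℝ) + 1) * θ = 2 * (k + 1 : ℕ) * θ + θ by ring, hrec]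
      congr 2; push_cast; ring
    have e2 : Real.sin (2 * ((k + 1 : ℕ) : ℝ) * θ) =
        2 * Real.cos θ * Real.sin ((2 * k + 1) * θ) - Real.sin (2 * k * θ) := by
      rw [show 2 * ((k + 1 : ℕ) : ℝ) * θ = (2 * k + 1) * θ + θ by push_cast; ring, hrec]
      congr 2; ring
    have e3 : Real.sin ((2 * k + 1) * θ) =
        2 * Real.cos θ * Real.sin (2 * k * θ) - Real.sin ((2 * k - 1) * θ) := by
      rw [show (2 * (k : ℝ) + 1) * θ = 2 * k * θ + θ by ring, hrec]
      congr 2; ring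
    have e4 : Real.sin ((2 * ((k + 1 : ℕ) : ℝ) - 1) * θ) = Real.sin ((2 * k + 1) * θ) := by
      congr 1; push_cast; ring
    rw [pow_succ', Module.End.mul_apply, Module.End.mul_apply, ← map_smul, ← map_smul, ih.1,
      Module.End.mul_apply, Module.End.mul_apply, ← map_smul, ← map_smul, ih.2, e1, e4, e2]
    constructor
    · simp [sigma_apply, h, ht]
      module
    · rw [e3]
      simp [sigma_apply, h, ht]
      module

lemma sigma_isLiftable (M : CoxeterMatrix B) : M.IsLiftable (sigma M) := by
  intro s t
  rcases eq_or_ne s t with rfl | hst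
  · ext1 x
    simp only [CoxeterMatrix.diagonal, pow_one]
    ext
    simp [sigma_sigma]
  rcases Nat.eq_zero_or_pos (M s t) with h0 | h0
  · simp [h0]
  have h2 : 2 ≤ M s t := by have := M.off_diagonal s t hst; omega
  set m := M s t with hm
  have h2' : (2 : ℝ) ≤ m := by exact_mod_cast h2
  set θ := Real.pi / m with hθ
  have hθm : m * θ = Real.pi := by rw [hθ]; field_simp
  have hst' : cartan M s t = -2 * Real.cos θ := rfl
  have hts : cartan M t s = -2 * Real.cos θ := by rw [cartan_comm, hst']
  have hs : 0 < Real.sin θ := by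
    apply Real.sin_pos_of_pos_of_lt_pi
    · positivity
    · rw [hθ, div_lt_iff₀ (by linarith)]; nlinarith [Real.pi_pos]
  obtain ⟨i1, i2⟩ := sigma_mul_pow_simpleRoot hst' m
  rw [show (2 * (m : ℝ) + 1) * θ = θ + 2 * Real.pi by rw [← hθm]; ring,
    show (2 * (m : ℝ)) * θ = 2 * Real.pi by rw [← hθm]; ring, Real.sin_add_two_pi,
    Real.sin_two_pi, zero_smul, add_zero] at i1
  rw [show (2 * (m : ℝ) - 1) * θ = 2 * Real.pi - θ by rw [← hθm]; ring,
    show (2 * (m : ℝ)) * θ = 2 * Real.pi by rw [← hθm]; ring, Real.sin_two_pi_sub,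
    Real.sin_two_pi, zero_smul, zero_add, neg_smul, neg_neg] at i2
  replace i1 := smul_right_injective _ hs.ne' i1
  replace i2 := smul_right_injective _ hs.ne' i2
  apply LinearMap.ext
  intro z
  have hfix : ∀ k : ℕ, ∀ y, coroot M s y = 0 → coroot M t y = 0 →
      ((sigma M s * sigma M t) ^ k) y = y := by
    intro k y h1 h2
    induction k with
    | zero => simp
    | succ k ih => simp [pow_succ', ih, sigma_apply, h1, h2]
  set D := 4 * Real.sin θ ^ 2 with hD
  have hD0 : D ≠ 0 := by positivity
  have hcs : Real.cos θ ^ 2 = 1 - D / 4 := by rw [hD, Real.sin_sq]; ring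
  set a := (2 * coroot M s z + 2 * Real.cos θ * coroot M t z) / D with ha
  set b := (2 * coroot M t z + 2 * Real.cos θ * coroot M s z) / D with hb
  have hz : z = a • simpleRoot s + b • simpleRoot t +
    (z - (a • simpleRoot s + b • simpleRoot t)) := by abel
  have hy := hfix m (z - (a • simpleRoot s + b • simpleRoot t))
    (by simp [hst', ha, hb]; field_simp; linear_combination (4 * coroot M s z) * hcs)
    (by simp [hts, ha, hb]; field_simp; linear_combination (4 * coroot M t z) * hcs)
  rw [hz, map_add, map_add, map_smul, map_smul, i1, i2, hy]
  simp

variable (cs : CoxeterSystem M W)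

/-- The geometric representation of a Coxeter group. -/
noncomputable def rep : W →* End ℝ (B → ℝ) := cs.lift ⟨sigma M, sigma_isLiftable M⟩

@[simp] lemma rep_simple (s : B) : rep cs (cs.simple s) = sigma M s :=
  cs.lift_apply_simple (sigma_isLiftable M) s

lemma rep_mul_apply (w w' : W) (x : B → ℝ) : rep cs (w * w') x = rep cs w (rep cs w' x) := by
  rw [map_mul, Module.End.mul_apply]

@[simp] lemma rep_apply_inv (w : W) (x : B → ℝ) : rep cs w (rep cs w⁻¹ x) = x := by
  rw [← rep_mul_apply]; simp

lemma form_rep (w : W) (x y : B → ℝ) : form M (rep cs w x) (rep cs w y) = form M x y := by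
  induction w using cs.simple_induction_left generalizing x y with
  | one => simp
  | mul_simple_left w i ih => rw [rep_mul_apply, rep_mul_apply, rep_simple, form_sigma, ih]

lemma form_rep_left (w : W) (x y : B → ℝ) :
    form M (rep cs w x) y = form M x (rep cs w⁻¹ y) := by
  rw [← form_rep cs w x, rep_apply_inv]

omit [DecidableEq B] [Fintype B] in
lemma commute_of_eq_two {s t : B} (h : M s t = 2) : Commute (cs.simple s) (cs.simple t) := by
  have := cs.simple_mul_simple_pow s t
  rw [h, pow_two] at this
  have h2 := eq_inv_of_mul_eq_one_left this
  rwa [mul_inv_rev, cs.inv_simple, cs.inv_simple] at h2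

omit [Fintype B] [DecidableEq B] in
/-- A property of simple reflections that propagates along the edges of the Coxeter diagram of an
irreducible system holds everywhere as soon as it holds somewhere. -/
lemma irreducible_induction (hirr : IsIrreducibleCS cs) (p : B → Prop) {s₀ : B} (h₀ : p s₀)
    (h : ∀ s t, p s → s ≠ t → M s t ≠ 2 → p t) (s : B) : p s := by
  rcases hirr.2 {s | p s} (fun a ha b hb => by
    have hab : a ≠ b := fun e => hb (e ▸ ha)
    by_contra hc
    exact hb (h a b ha hab fun h2 => hc (commute_of_eq_two cs h2))) with hp | hp
  · exact absurd h₀ (by simpa using Set.eq_empty_iff_forall_notMem.1 hp s₀)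
  · exact Set.eq_univ_iff_forall.1 hp s

/-- The form is positive definite when the group is finite and irreducible. -/
theorem form_posDef [Fintype W] (hirr : IsIrreducibleCS cs) {x : B → ℝ} (hx : x ≠ 0) :
    0 < form M x x := by
  let D : (B → ℝ) →ₗ[ℝ] (B → ℝ) →ₗ[ℝ] ℝ := ∑ w : W, ∑ b : B,
    ((LinearMap.proj (R := ℝ) (φ := fun _ : B => ℝ) b).comp (rep cs w)).smulRight
      ((LinearMap.proj (R := ℝ) (φ := fun _ : B => ℝ) b).comp (rep cs w))
  have hD (x y) : D x y = ∑ w : W, ∑ b : B, rep cs w x b * rep cs w y b := by simp [D]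
  have hcomm (x y) : D x y = D y x := by simp only [hD, mul_comm]
  have hinv (v : W) (x y) : D (rep cs v x) (rep cs v y) = D x y := by
    simp only [hD, ← rep_mul_apply]
    exact Fintype.sum_equiv (Equiv.mulRight v) _ _ fun w => by simp
  have hpos {x} (hx : x ≠ 0) : 0 < D x x := by
    rw [hD]
    apply Finset.sum_pos'
    · exact fun w _ => Finset.sum_nonneg fun b _ => mul_self_nonneg _
    · refine ⟨1, Finset.mem_univ _, ?_⟩
      obtain ⟨b, hb⟩ := Function.ne_iff.1 hx
      refine Finset.sum_pos' (fun b _ => mul_self_nonneg _) ⟨b, Finset.mem_univ _, ?_⟩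
      simpa using hb
  have hα (s : B) : simpleRoot s ≠ 0 := fun h => by simpa using congrFun h s
  have key (s : B) (x) : 2 * D x (simpleRoot s) =
      coroot M s x * D (simpleRoot s) (simpleRoot s) := by
    have := hinv (cs.simple s) x (simpleRoot s)
    simp [sigma_apply] at this
    linarith
  obtain ⟨s₀⟩ := hirr.1
  have hconst := irreducible_induction cs hirr
    (fun s => D (simpleRoot s) (simpleRoot s) = D (simpleRoot s₀) (simpleRoot s₀)) rfl
    (fun s t hs hst h2 => by
      have h1 := key s (simpleRoot t)
      have h3 := key t (simpleRoot s)
      rw [hcomm, coroot_simpleRoot, cartan_comm] at h3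
      rw [coroot_simpleRoot, h3] at h1
      rw [← hs]
      exact mul_left_cancel₀ (by linarith [cartan_le_neg_one hst h2]) h1)
  have hform : 2 * D x x = form M x x * D (simpleRoot s₀) (simpleRoot s₀) := by
    have hsum : x = ∑ s, x s • simpleRoot s := by
      ext b; simp [simpleRoot, Pi.single_apply]
    conv_lhs => rw [hsum]
    rw [map_sum, Finset.mul_sum, form_apply, Finset.sum_mul]
    refine Finset.sum_congr rfl fun s _ => ?_
    rw [← hsum, map_smul, smul_eq_mul, mul_left_comm, key, hconst, mul_assoc]
  nlinarith [hpos hx, hpos (hα s₀)]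

end

section

open Module

variable {B W : Type*} [Fintype B] [DecidableEq B] [Group W] {M : CoxeterMatrix B}
variable (cs : CoxeterSystem M W)

lemma sin_pi_div_nonneg {m j : ℕ} (h : j ≤ m) : 0 ≤ Real.sin (j * (Real.pi / m)) := by
  rcases Nat.eq_zero_or_pos m with rfl | hm
  · simp
  have hm' : (0 : ℝ) < m := by exact_mod_cast hm
  apply Real.sin_nonneg_of_nonneg_of_le_pi
  · positivity
  · rw [← mul_div_assoc, div_le_iff₀ hm', mul_comm]
    exact mul_le_mul_of_nonneg_left (by exact_mod_cast h) Real.pi_pos.le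

lemma sin_pi_div_pos {m : ℕ} (h : 2 ≤ m) : 0 < Real.sin (Real.pi / m) := by
  have hm' : (2 : ℝ) ≤ m := by exact_mod_cast h
  apply Real.sin_pos_of_pos_of_lt_pi
  · positivity
  · rw [div_lt_iff₀ (by linarith)]; nlinarith [Real.pi_pos]

lemma rep_alternatingWord_simpleRoot (s t : B) (k : ℕ) :
    Real.sin (Real.pi / M s t) • rep cs (cs.wordProd (CoxeterSystem.alternatingWord s t k))
        (simpleRoot s) =
      if Even k then
        Real.sin ((k + 1 : ℕ) * (Real.pi / M s t)) • simpleRoot s +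
          Real.sin (k * (Real.pi / M s t)) • simpleRoot t
      else
        Real.sin (k * (Real.pi / M s t)) • simpleRoot s +
          Real.sin ((k + 1 : ℕ) * (Real.pi / M s t)) • simpleRoot t := by
  have hst : cartan M s t = -2 * Real.cos (Real.pi / M s t) := rfl
  have hts : cartan M t s = -2 * Real.cos (Real.pi / M s t) := by rw [cartan_comm, hst]
  generalize Real.pi / M s t = θ at *
  induction k with
  | zero => simp [CoxeterSystem.alternatingWord]
  | succ k ih =>
    have e : Real.sin ((k + 1 + 1 : ℕ) * θ) =
        2 * Real.cos θ * Real.sin ((k + 1 : ℕ) * θ) - Real.sin (k * θ) := by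
      rw [show ((k + 1 + 1 : ℕ) : ℝ) * θ = (k + 1 : ℕ) * θ + θ by push_cast; ring,
        show (k : ℝ) * θ = (k + 1 : ℕ) * θ - θ by push_cast; ring, Real.sin_add, Real.sin_sub]
      ring
    rw [CoxeterSystem.alternatingWord_succ', cs.wordProd_cons, rep_mul_apply, rep_simple,
      ← map_smul, ih, e]
    by_cases hk : Even k
    · simp only [hk, if_true, Nat.even_add_one, not_true, if_false]
      simp [sigma_apply, hts]
      module
    · simp only [hk, if_false, Nat.even_add_one, not_false_eq_true, if_true]
      simp [sigma_apply, hst]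
      module

lemma ne_zero_of_irreducible [Fintype W] (hirr : IsIrreducibleCS cs) (s t : B) : M s t ≠ 0 := by
  intro h
  have hst : s ≠ t := by rintro rfl; simp at h
  have hne : simpleRoot s + simpleRoot t ≠ 0 := fun h' => by
    simpa [simpleRoot_of_ne hst] using congrFun h' s
  have := form_posDef cs hirr hne
  have h2 : cartan M s t = -2 := by simp [cartan, h]
  have h3 : cartan M t s = -2 := by rw [cartan_comm, h2]
  simp [h2, h3] at this

/-- If `s` is not a right descent of `w` then `w α_s` is a nonnegative root. -/
theorem rep_simpleRoot_nonneg [Fintype W] (hirr : IsIrreducibleCS cs) {w : W} {s : B}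
    (hs : ¬ cs.IsRightDescent w s) : 0 ≤ rep cs w (simpleRoot s) := by
  induction hn : cs.length w using Nat.strong_induction_on generalizing w s with
  | _ n ih =>
  subst hn
  rcases eq_or_ne w 1 with rfl | hw
  · rw [map_one, Module.End.one_apply]
    exact Pi.single_nonneg.2 zero_le_one
  obtain ⟨t, ht⟩ := cs.exists_rightDescent_of_ne_one hw
  have hst : s ≠ t := fun h => hs (h ▸ ht)
  have h2 : 2 ≤ M s t := by
    have := M.off_diagonal s t hst
    have := ne_zero_of_irreducible cs hirr s t
    omega
  let a (k : ℕ) : W := cs.wordProd (CoxeterSystem.alternatingWord s t k)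
  have ha (k : ℕ) : a (k + 1) = cs.simple (if Even k then t else s) * a k := by
    simp only [a]
    rw [CoxeterSystem.alternatingWord_succ', cs.wordProd_cons]
  have hal (k : ℕ) : cs.length (a k) ≤ k := by
    simpa using cs.length_wordProd_le (CoxeterSystem.alternatingWord s t k)
  let P (k : ℕ) : Prop := cs.length (w * (a k)⁻¹) + k = cs.length w
  have hP1 : P 1 := by
    have : a 1 = cs.simple t := by simp [a, CoxeterSystem.alternatingWord]
    simp only [P, this, cs.inv_simple]
    exact (cs.isRightDescent_iff).1 ht
  classical
  have hlen : 1 ≤ cs.length w := by simp only [P] at hP1; omega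
  set k := Nat.findGreatest P (cs.length w) with hk
  have hPk : P k := Nat.findGreatest_spec hlen hP1
  have hk1 : 1 ≤ k := Nat.le_findGreatest hlen hP1
  have hnP : ¬ P (k + 1) := fun h =>
    Nat.findGreatest_is_greatest (Nat.lt_succ_self k) (by simp only [P] at h; omega) h
  set v := w * (a k)⁻¹ with hv
  have hwv : w = v * a k := by simp [hv]
  have hPk' : cs.length v + k = cs.length w := hPk
  have hd1 : ¬ cs.IsRightDescent v (if Even k then t else s) := by
    intro h
    rw [cs.isRightDescent_iff] at h
    apply hnP
    have : w * (a (k + 1))⁻¹ = v * cs.simple (if Even k then t else s) := by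
      rw [ha, mul_inv_rev, cs.inv_simple, hv, mul_assoc]
    simp only [P, this]
    omega
  have hd2 : ¬ cs.IsRightDescent v (if Even k then s else t) := by
    intro h
    rw [cs.isRightDescent_iff] at h
    obtain ⟨k', hk'⟩ : ∃ k', k = k' + 1 := ⟨k - 1, by omega⟩
    have e1 : (if Even k then s else t) = if Even k' then t else s := by
      rw [hk']; by_cases hh : Even k' <;> simp [hh, Nat.even_add_one]
    rw [e1] at h
    have e2 : w = v * cs.simple (if Even k' then t else s) * a k' := by
      rw [mul_assoc, ← ha, ← hk', ← hwv]
    have h3 := cs.length_mul_le (v * cs.simple (if Even k' then t else s)) (a k')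
    rw [← e2] at h3
    have := hal k'
    omega
  have hvs : 0 ≤ rep cs v (simpleRoot s) ∧ 0 ≤ rep cs v (simpleRoot t) := by
    have i1 := ih _ (by omega) hd1 rfl
    have i2 := ih _ (by omega) hd2 rfl
    by_cases hh : Even k
    · simp only [hh, if_true] at i1 i2
      exact ⟨i2, i1⟩
    · simp only [hh, if_false] at i1 i2
      exact ⟨i1, i2⟩
  have hkm : k + 1 ≤ M s t := by
    by_contra hc
    have hnr := cs.not_isReduced_alternatingWord t s (m := k + 1)
      (by rw [M.symmetric]; omega) (by rw [M.symmetric]; omega)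
    have hle := cs.length_wordProd_le (CoxeterSystem.alternatingWord t s (k + 1))
    rw [CoxeterSystem.IsReduced] at hnr
    rw [CoxeterSystem.length_alternatingWord] at hnr hle
    have e : w * cs.simple s = v * cs.wordProd (CoxeterSystem.alternatingWord t s (k + 1)) := by
      rw [CoxeterSystem.alternatingWord_succ, cs.wordProd_concat, ← mul_assoc, ← hwv]
    have h3 := cs.length_mul_le v (cs.wordProd (CoxeterSystem.alternatingWord t s (k + 1)))
    rw [← e] at h3
    have := cs.length_mul_simple_ne w s
    exact hs (by rw [CoxeterSystem.IsRightDescent]; omega)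
  have hpos := sin_pi_div_pos h2
  have hmain : 0 ≤ Real.sin (Real.pi / M s t) • rep cs w (simpleRoot s) := by
    rw [hwv, rep_mul_apply, ← map_smul, rep_alternatingWord_simpleRoot]
    have s1 := sin_pi_div_nonneg hkm
    have s2 := sin_pi_div_nonneg (show k ≤ M s t by omega)
    split_ifs <;> rw [map_add, map_smul, map_smul]
    · exact add_nonneg (smul_nonneg s1 hvs.1) (smul_nonneg s2 hvs.2)
    · exact add_nonneg (smul_nonneg s2 hvs.1) (smul_nonneg s1 hvs.2)
  exact fun b => nonneg_of_mul_nonneg_right (hmain b) hpos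

variable [Fintype W] (hirr : IsIrreducibleCS cs)
include hirr

lemma rep_simpleRoot_nonpos {w : W} {s : B} (hs : cs.IsRightDescent w s) :
    rep cs w (simpleRoot s) ≤ 0 := by
  have := rep_simpleRoot_nonneg cs hirr
    ((cs.isRightDescent_iff_not_isRightDescent_mul).1 hs)
  rw [rep_mul_apply, rep_simple, sigma_apply] at this
  simp only [coroot_simpleRoot, cartan_self] at this
  have e : simpleRoot s - (2 : ℝ) • simpleRoot s = -simpleRoot s := by module
  rw [e, map_neg] at this
  exact neg_nonneg.1 this

/-- An element that scales a strictly positive functional by a positive factor is trivial. -/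
lemma eq_one_of_functional_scaled {w : W} {v : B → ℝ} (hv : ∀ s, 0 < v s) {μ : ℝ} (hμ : 0 < μ)
    (h : ∀ x : B → ℝ, ∑ s, v s * rep cs w x s = μ * ∑ s, v s * x s) : w = 1 := by
  by_contra hw
  obtain ⟨s, hs⟩ := cs.exists_rightDescent_of_ne_one hw
  have h1 := h (simpleRoot s)
  have h2 : ∑ r, v r * rep cs w (simpleRoot s) r ≤ 0 :=
    Finset.sum_nonpos fun r _ =>
      mul_nonpos_of_nonneg_of_nonpos (hv r).le (rep_simpleRoot_nonpos cs hirr hs r)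
  have h3 : ∑ r, v r * simpleRoot s r = v s := by simp [simpleRoot, Pi.single_apply]
  rw [h3] at h1
  nlinarith [mul_pos hμ (hv s)]

lemma rep_injective : Function.Injective (rep cs) := by
  rw [injective_iff_map_eq_one]
  intro w hw
  exact eq_one_of_functional_scaled cs hirr (v := fun _ => 1) (fun _ => one_pos) one_pos
    (by simp [hw])

omit [Fintype W] hirr in
lemma simple_injective : Function.Injective cs.simple := by
  intro s t h
  by_contra hst
  have := congrArg (fun w => rep cs w (simpleRoot s) s) h
  simp [sigma_apply, simpleRoot_of_ne hst] at this

omit hirr [Fintype W] in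
/-- `β` is one of the two roots `± β` of the reflection `t`. -/
def IsRootOf (t : W) (β : B → ℝ) : Prop :=
  ∃ w s, t = w * cs.simple s * w⁻¹ ∧ β = rep cs w (simpleRoot s)

variable {cs}

omit hirr [Fintype W] in
lemma IsRootOf.rep_apply {t : W} {β : B → ℝ} (h : IsRootOf cs t β) (x : B → ℝ) :
    rep cs t x = x - form M β x • β := by
  obtain ⟨w, s, rfl, rfl⟩ := h
  rw [rep_mul_apply, rep_mul_apply, rep_simple, sigma_apply, map_sub, rep_apply_inv, map_smul,
    form_rep_left, form_simpleRoot_left]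

omit hirr [Fintype W] in
lemma IsRootOf.form_self {t : W} {β : B → ℝ} (h : IsRootOf cs t β) : form M β β = 2 := by
  obtain ⟨w, s, rfl, rfl⟩ := h
  simp [form_rep]

omit hirr [Fintype W] in
lemma IsRootOf.ne_zero {t : W} {β : B → ℝ} (h : IsRootOf cs t β) : β ≠ 0 := by
  rintro rfl
  simpa using h.form_self

omit hirr [Fintype W] in
lemma IsRootOf.conj {t : W} {β : B → ℝ} (h : IsRootOf cs t β) (g : W) :
    IsRootOf cs (g * t * g⁻¹) (rep cs g β) := by
  obtain ⟨w, s, rfl, rfl⟩ := h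
  exact ⟨g * w, s, by group, by rw [rep_mul_apply]⟩

omit hirr [Fintype W] in
lemma IsRootOf.neg {t : W} {β : B → ℝ} (h : IsRootOf cs t β) : IsRootOf cs t (-β) := by
  obtain ⟨w, s, rfl, rfl⟩ := h
  refine ⟨w * cs.simple s, s, by simp [mul_assoc], ?_⟩
  rw [rep_mul_apply, rep_simple, sigma_apply, ← map_neg]
  simp only [coroot_simpleRoot, cartan_self]
  congr 1
  module

lemma IsRootOf.nonneg_or_nonpos {t : W} {β : B → ℝ} (h : IsRootOf cs t β) : 0 ≤ β ∨ β ≤ 0 := by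
  obtain ⟨w, s, rfl, rfl⟩ := h
  by_cases hs : cs.IsRightDescent w s
  · exact Or.inr (rep_simpleRoot_nonpos cs hirr hs)
  · exact Or.inl (rep_simpleRoot_nonneg cs hirr hs)

lemma IsRootOf.unique {t t' : W} {β : B → ℝ} (h : IsRootOf cs t β) (h' : IsRootOf cs t' β) :
    t = t' := by
  apply rep_injective cs hirr
  ext1 x
  ext
  simp [h.rep_apply, h'.rep_apply]

lemma exists_nonneg_root {t : W} (ht : cs.IsReflection t) : ∃ β, IsRootOf cs t β ∧ 0 ≤ β := by
  obtain ⟨w, s, rfl⟩ := ht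
  have h : IsRootOf cs (w * cs.simple s * w⁻¹) (rep cs w (simpleRoot s)) := ⟨w, s, rfl, rfl⟩
  rcases h.nonneg_or_nonpos hirr with hβ | hβ
  · exact ⟨_, h, hβ⟩
  · exact ⟨_, h.neg, neg_nonneg.2 hβ⟩

/-- A reflection whose root is supported on `J` is conjugate, inside the standard parabolic
subgroup of `J`, to a simple reflection in `J`. -/
theorem IsRootOf.exists_conj_of_support {t : W} {β : B → ℝ} (h : IsRootOf cs t β) {J : Set B}
    (hJ : ∀ r ∉ J, β r = 0) :
    ∃ g ∈ Subgroup.closure (cs.simple '' J), ∃ s ∈ J, t = g * cs.simple s * g⁻¹ := by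
  induction hn : cs.length t using Nat.strong_induction_on generalizing t β with
  | _ n ih =>
  subst hn
  wlog hβ : 0 ≤ β generalizing β
  · exact this h.neg (fun r hr => by simp [hJ r hr])
      (neg_nonneg.2 ((h.nonneg_or_nonpos hirr).resolve_left hβ))
  obtain ⟨r, hrJ, hr⟩ : ∃ r ∈ J, 0 < coroot M r β := by
    by_contra! hc
    have h2 := h.form_self
    have : form M β β ≤ 0 := by
      rw [form_apply]
      refine Finset.sum_nonpos fun r _ => ?_
      by_cases hrJ : r ∈ J
      · exact mul_nonpos_of_nonneg_of_nonpos (hβ r) (hc r hrJ)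
      · simp [hJ r hrJ]
    linarith
  by_cases hne : ∃ b, b ≠ r ∧ 0 < β b
  · obtain ⟨b, hbr, hb⟩ := hne
    have hr' : form M β (simpleRoot r) = coroot M r β := by simp
    have d1 : cs.IsRightDescent t r := by
      by_contra hd
      have := rep_simpleRoot_nonneg cs hirr hd b
      rw [h.rep_apply, hr'] at this
      simp [simpleRoot_of_ne hbr] at this
      nlinarith
    have d2 : cs.IsRightDescent (t * cs.simple r)⁻¹ r := by
      by_contra hd
      have := rep_simpleRoot_nonneg cs hirr hd b
      have htinv : t⁻¹ = t := by
        obtain ⟨w, s, rfl, -⟩ := h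
        simp [mul_assoc]
      rw [mul_inv_rev, cs.inv_simple, htinv, rep_mul_apply, h.rep_apply, hr', rep_simple,
        sigma_apply_of_ne hbr] at this
      simp [simpleRoot_of_ne hbr] at this
      nlinarith
    have hlt : cs.length (cs.simple r * t * (cs.simple r)⁻¹) < cs.length t := by
      rw [cs.isRightDescent_inv_iff, CoxeterSystem.IsLeftDescent, ← mul_assoc] at d2
      rw [CoxeterSystem.IsRightDescent] at d1
      rw [cs.inv_simple]
      omega
    obtain ⟨g, hg, s, hs, e⟩ := ih _ hlt (h.conj (cs.simple r)) (fun b hb => by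
      rw [rep_simple, sigma_apply_of_ne (by rintro rfl; exact hb hrJ), hJ b hb]) rfl
    refine ⟨cs.simple r * g, mul_mem (Subgroup.subset_closure ⟨r, hrJ, rfl⟩) hg, s, hs, ?_⟩
    have : t = cs.simple r * (cs.simple r * t * (cs.simple r)⁻¹) * cs.simple r := by
      simp [mul_assoc]
    rw [this, e]
    simp [mul_assoc]
  · push Not at hne
    have hβr : β = β r • simpleRoot r := by
      ext b
      rcases eq_or_ne b r with rfl | hb
      · simp
      · simp [simpleRoot_of_ne hb, le_antisymm (hne b hb) (hβ b)]
    have hf := h.form_self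
    rw [hβr] at hf
    simp at hf
    have h1 : β r = 1 := by
      have := hβ r
      simp at this
      nlinarith
    rw [h1, one_smul] at hβr
    refine ⟨1, one_mem _, r, hrJ, ?_⟩
    refine h.unique hirr ⟨1, r, by simp, by simp [hβr]⟩

end

section

open Module

variable {B W : Type*} [Fintype B] [DecidableEq B] [Group W] {M : CoxeterMatrix B}
variable {cs : CoxeterSystem M W}

/-- The displacement of a product of reflections lies in a subspace spanned by one root for each
factor. -/
lemma exists_submodule_of_reflections (L : List W) (hL : ∀ t ∈ L, cs.IsReflection t) :
    ∃ U : Submodule ℝ (B → ℝ), finrank ℝ U ≤ L.length ∧ (∀ x, rep cs L.prod x - x ∈ U) ∧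
      ∀ t ∈ L, ∃ β ∈ U, IsRootOf cs t β := by
  induction L with
  | nil => exact ⟨⊥, by simp⟩
  | cons t L ih =>
    obtain ⟨U, hU, hdis, hroot⟩ := ih fun u hu => hL u (by simp [hu])
    obtain ⟨w, s, ht⟩ := hL t (by simp)
    have hβ : IsRootOf cs t (rep cs w (simpleRoot s)) := ⟨w, s, ht, rfl⟩
    set β := rep cs w (simpleRoot s)
    have hmem : β ∈ Submodule.span ℝ {β} ⊔ U :=
      Submodule.mem_sup_left (Submodule.mem_span_singleton_self β)
    refine ⟨Submodule.span ℝ {β} ⊔ U, ?_, fun x => ?_, fun u hu => ?_⟩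
    · have h1 := Submodule.finrank_add_le_finrank_add_finrank (Submodule.span ℝ {β}) U
      have h2 := finrank_span_singleton (K := ℝ) hβ.ne_zero
      simp only [List.length_cons]
      omega
    · rw [List.prod_cons, rep_mul_apply, hβ.rep_apply, sub_right_comm]
      exact sub_mem (Submodule.mem_sup_right (hdis x)) (Submodule.smul_mem _ _ hmem)
    · rcases List.mem_cons.1 hu with rfl | hu
      · exact ⟨β, hmem, hβ⟩
      · obtain ⟨γ, hγ, h⟩ := hroot u hu
        exact ⟨γ, Submodule.mem_sup_right hγ, h⟩

lemma rep_wordProd_apply_of_notMem (l : List B) {r : B} (hr : r ∉ l) (x : B → ℝ) :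
    rep cs (cs.wordProd l) x r = x r := by
  induction l with
  | nil => simp
  | cons s l ih =>
    simp only [List.mem_cons, not_or] at hr
    rw [cs.wordProd_cons, rep_mul_apply, rep_simple, sigma_apply_of_ne hr.1, ih hr.2]

lemma coroot_eq_zero_of_rep_wordProd_eq (l : List B) (hl : l.Nodup) {x : B → ℝ}
    (hx : rep cs (cs.wordProd l) x = x) : ∀ s ∈ l, coroot M s x = 0 := by
  induction l with
  | nil => simp
  | cons s l ih =>
    rw [List.nodup_cons] at hl
    rw [cs.wordProd_cons, rep_mul_apply, rep_simple, sigma_apply] at hx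
    have h0 := congrFun hx s
    simp [rep_wordProd_apply_of_notMem l hl.1] at h0
    rw [h0, zero_smul, sub_zero] at hx
    rw [hx] at h0
    intro r hr
    rcases List.mem_cons.1 hr with rfl | hr
    · exact h0
    · exact ih hl.2 hx r hr

/-- The span of the simple roots indexed by a list. -/
def simpleSpan (l : List B) : Submodule ℝ (B → ℝ) :=
  Submodule.span ℝ (simpleRoot '' (l.toFinset : Set B))

omit [Fintype B] in
lemma apply_eq_zero_of_mem_simpleSpan {l : List B} {x : B → ℝ} (hx : x ∈ simpleSpan l) {r : B}
    (hr : r ∉ l) : x r = 0 := by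
  have : simpleSpan l ≤ LinearMap.ker (LinearMap.proj (R := ℝ) (φ := fun _ : B => ℝ) r) := by
    rw [simpleSpan, Submodule.span_le]
    rintro _ ⟨s, hs, rfl⟩
    have : r ≠ s := by rintro rfl; exact hr (by simpa using hs)
    simp [simpleRoot_of_ne this]
  simpa using this hx

omit [Fintype B] in
lemma simpleRoot_mem_simpleSpan {l : List B} {s : B} (hs : s ∈ l) : simpleRoot s ∈ simpleSpan l :=
  Submodule.subset_span ⟨s, by simpa using hs, rfl⟩

lemma finrank_simpleSpan {l : List B} (hl : l.Nodup) : finrank ℝ (simpleSpan l) = l.length := by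
  have hli : LinearIndependent ℝ (simpleRoot : B → B → ℝ) := by
    have := (Pi.basisFun ℝ B).linearIndependent
    convert this using 2
    ext; simp [simpleRoot]
  have h2 : LinearIndependent ℝ (fun s : l.toFinset => simpleRoot (s : B)) :=
    hli.comp _ Subtype.val_injective
  have := finrank_span_eq_card h2
  rw [Fintype.card_coe, List.toFinset_card_of_nodup hl] at this
  have hr : Set.range (fun s : l.toFinset => simpleRoot (s : B)) =
      simpleRoot '' (l.toFinset : Set B) := by
    ext x; simp
  rw [← this, hr, simpleSpan]

lemma rep_wordProd_sub_mem (l : List B) (x : B → ℝ) :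
    rep cs (cs.wordProd l) x - x ∈ simpleSpan l := by
  induction l with
  | nil => simp
  | cons s l ih =>
    rw [cs.wordProd_cons, rep_mul_apply, rep_simple, sigma_apply, sub_right_comm]
    refine sub_mem (Submodule.span_mono ?_ ih)
      (Submodule.smul_mem _ _ (simpleRoot_mem_simpleSpan (by simp)))
    exact Set.image_mono fun r hr => by simp at hr ⊢; exact Or.inr hr

variable [Fintype W] (hirr : IsIrreducibleCS cs)
include hirr

/-- A product of `k` distinct simple reflections is not a product of fewer than `k` reflections,
and in any expression as a product of `k` reflections, the roots of the factors lie in the span of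
the given simple roots. -/
theorem reflection_factorization (l : List B) (hl : l.Nodup) (L : List W)
    (hL : ∀ t ∈ L, cs.IsReflection t) (hprod : L.prod = cs.wordProd l) :
    l.length ≤ L.length ∧ (L.length = l.length →
      ∀ t ∈ L, ∃ β, IsRootOf cs t β ∧ ∀ r ∉ l, β r = 0) := by
  obtain ⟨U, hU, hdis, hroot⟩ := exists_submodule_of_reflections L hL
  rw [hprod] at hdis
  let φ : End ℝ (B → ℝ) := rep cs (cs.wordProd l) - 1
  have hφ (x) : φ x = rep cs (cs.wordProd l) x - x := by simp [φ]
  have hinj : ∀ x ∈ simpleSpan l, φ x = 0 → x = 0 := by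
    intro x hx h0
    rw [hφ, sub_eq_zero] at h0
    have h1 := coroot_eq_zero_of_rep_wordProd_eq l hl h0
    by_contra hne
    have := form_posDef cs hirr hne
    rw [form_apply, Finset.sum_eq_zero] at this
    · exact lt_irrefl _ this
    · intro s _
      by_cases hs : s ∈ l
      · rw [h1 s hs, mul_zero]
      · rw [apply_eq_zero_of_mem_simpleSpan hx hs, zero_mul]
  have hrank : finrank ℝ ((simpleSpan l).map φ) = l.length := by
    rw [← finrank_simpleSpan hl]
    have hinj' : Function.Injective (φ.domRestrict (simpleSpan l)) := by
      rw [← LinearMap.ker_eq_bot, LinearMap.ker_eq_bot']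
      intro x hx
      exact Subtype.ext (hinj x x.2 hx)
    have := LinearMap.finrank_range_of_inj hinj'
    rwa [LinearMap.range_domRestrict] at this
  have hleU : (simpleSpan l).map φ ≤ U := by
    rintro _ ⟨x, -, rfl⟩
    rw [hφ]; exact hdis x
  have hleE : (simpleSpan l).map φ ≤ simpleSpan l := by
    rintro _ ⟨x, -, rfl⟩
    rw [hφ]; exact rep_wordProd_sub_mem l x
  have hUle := Submodule.finrank_mono hleU
  refine ⟨by omega, fun hlen t ht => ?_⟩
  have e1 := Submodule.eq_of_le_of_finrank_le hleU (by omega)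
  have e2 := Submodule.eq_of_le_of_finrank_le hleE (by rw [finrank_simpleSpan hl]; omega)
  obtain ⟨β, hβ, h⟩ := hroot t ht
  rw [← e1, e2] at hβ
  exact ⟨β, h, fun r hr => apply_eq_zero_of_mem_simpleSpan hβ hr⟩

end

section

variable {B W : Type*} [Group W] {M : CoxeterMatrix B}

/-- Elementary moves between words: exchanging adjacent commuting letters, and rotation. -/
inductive CoxeterMove (M : CoxeterMatrix B) : List B → List B → Prop
  | swap (l l' : List B) (a b : B) (h : M a b = 2) :
      CoxeterMove M (l ++ a :: b :: l') (l ++ b :: a :: l')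
  | rotate (a : B) (l : List B) : CoxeterMove M (a :: l) (l ++ [a])

lemma CoxeterMove.perm {l l' : List B} (h : CoxeterMove M l l') : l.Perm l' := by
  cases h with
  | swap l l' a b h => exact (List.Perm.swap b a l').append_left l
  | rotate a l => exact (List.perm_append_singleton a l).symm

lemma CoxeterMove.isConj (cs : CoxeterSystem M W) {l l' : List B} (h : CoxeterMove M l l') :
    IsConj (cs.wordProd l) (cs.wordProd l') := by
  cases h with
  | swap l l' a b h =>
    rw [cs.wordProd_append, cs.wordProd_append, cs.wordProd_cons, cs.wordProd_cons,
      cs.wordProd_cons, cs.wordProd_cons, ← mul_assoc (cs.simple a), ← mul_assoc (cs.simple b),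
      (commute_of_eq_two cs h).eq]
  | rotate a l =>
    rw [isConj_iff]
    refine ⟨(cs.simple a)⁻¹, ?_⟩
    rw [cs.wordProd_cons, cs.wordProd_append, cs.wordProd_singleton]
    simp

/-- The equivalence of words generated by the elementary moves. -/
abbrev CoxeterEquiv (M : CoxeterMatrix B) : List B → List B → Prop :=
  Relation.EqvGen (CoxeterMove M)

lemma CoxeterEquiv.perm {l l' : List B} (h : CoxeterEquiv M l l') : l.Perm l' := by
  induction h with
  | rel _ _ h => exact h.perm
  | refl => exact List.Perm.refl _
  | symm _ _ _ ih => exact ih.symm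
  | trans _ _ _ _ _ ih ih' => exact ih.trans ih'

lemma CoxeterEquiv.isConj (cs : CoxeterSystem M W) {l l' : List B} (h : CoxeterEquiv M l l') :
    IsConj (cs.wordProd l) (cs.wordProd l') := by
  induction h with
  | rel _ _ h => exact h.isConj cs
  | refl => exact IsConj.refl _
  | symm _ _ _ ih => exact ih.symm
  | trans _ _ _ _ _ ih ih' => exact ih.trans ih'

lemma CoxeterEquiv.move_past (s : B) (m m₁ m₂ : List B) (h : ∀ b ∈ m, M s b = 2) :
    CoxeterEquiv M (m₁ ++ m ++ s :: m₂) (m₁ ++ s :: (m ++ m₂)) := by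
  induction m generalizing m₁ with
  | nil => simpa using Relation.EqvGen.refl _
  | cons b m ih =>
    have h1 := ih (m₁ ++ [b]) fun c hc => h c (by simp [hc])
    simp only [List.append_assoc, List.cons_append, List.nil_append] at h1 ⊢
    exact h1.trans _ _ _ (.rel _ _ (.swap m₁ (m ++ m₂) b s
      (by rw [M.symmetric]; exact h b (by simp))))

lemma CoxeterEquiv.rotate_append (l l' : List B) : CoxeterEquiv M (l ++ l') (l' ++ l) := by
  induction l generalizing l' with
  | nil => simpa using Relation.EqvGen.refl _
  | cons a l ih =>
    have h1 : CoxeterEquiv M (a :: (l ++ l')) (l ++ (l' ++ [a])) := by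
      rw [← List.append_assoc]; exact .rel _ _ (.rotate _ _)
    have h2 := ih (l' ++ [a])
    simp only [List.append_assoc, List.cons_append, List.nil_append] at h2
    exact h1.trans _ _ _ h2

/-- Every subset of the diagram has a vertex with at most one neighbour in that subset. -/
def IsForestLike (M : CoxeterMatrix B) : Prop :=
  ∀ J : Finset B, J.Nonempty → ∃ s ∈ J, ∀ a ∈ J, ∀ b ∈ J,
    a ≠ s → b ≠ s → M s a ≠ 2 → M s b ≠ 2 → a = b

lemma CoxeterEquiv.cons_leaf {s : B} {l l' : List B} (h : CoxeterEquiv M l l')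
    (hnd : l.Nodup) (hleaf : ∀ a ∈ l, ∀ b ∈ l, M s a ≠ 2 → M s b ≠ 2 → a = b) :
    CoxeterEquiv M (s :: l) (s :: l') := by
  induction h with
  | rel l l' h =>
    cases h with
    | swap l l' a b h => exact .rel _ _ (.swap (s :: l) l' a b h)
    | rotate a m =>
      by_cases ha : M s a = 2
      · have h1 : CoxeterEquiv M (s :: a :: m) (a :: s :: m) := .rel _ _ (.swap [] m s a ha)
        exact h1.trans _ _ _ (.rel _ _ (.rotate a (s :: m)))
      · have hm : ∀ b ∈ m, M s b = 2 := by
          intro b hb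
          by_contra hb'
          have := hleaf a (by simp) b (by simp [hb]) ha hb'
          subst this
          simp [hb] at hnd
        have h1 : CoxeterEquiv M (s :: a :: m) ((a :: m) ++ [s]) := .rel _ _ (.rotate s (a :: m))
        have h2 := CoxeterEquiv.move_past s m [a] [] hm
        simp only [List.cons_append, List.nil_append, List.append_nil] at h2
        exact (h1.trans _ _ _ h2).trans _ _ _ (.rel _ _ (.rotate a (s :: m)))
  | refl => exact .refl _
  | symm l l' h ih =>
    have hp := CoxeterEquiv.perm h
    exact (ih (hp.nodup_iff.2 hnd) fun a ha b hb =>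
      hleaf a (hp.mem_iff.1 ha) b (hp.mem_iff.1 hb)).symm
  | trans l l' l'' h h' ih ih' =>
    have hp := CoxeterEquiv.perm h
    exact (ih hnd hleaf).trans _ _ _ (ih' (hp.nodup_iff.1 hnd) fun a ha b hb =>
      hleaf a (hp.mem_iff.2 ha) b (hp.mem_iff.2 hb))

variable [DecidableEq B]

/-- On a forest, all orderings of the same set of vertices are equivalent. -/
theorem CoxeterEquiv.of_perm (hM : IsForestLike M) {l l' : List B} (hnd : l.Nodup)
    (hp : l.Perm l') : CoxeterEquiv M l l' := by
  induction hn : l.length generalizing l l' with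
  | zero =>
    obtain rfl := List.length_eq_zero_iff.1 hn
    rw [hp.nil_eq]
    exact .refl _
  | succ n ih =>
    obtain ⟨s, hs, hleaf⟩ := hM l.toFinset (by
      rw [List.toFinset_nonempty_iff]; rintro rfl; simp at hn)
    simp only [List.mem_toFinset] at hs hleaf
    have key (k : List B) (hk : k.Perm l) : ∃ m, CoxeterEquiv M k (s :: m) := by
      obtain ⟨a, b, rfl⟩ := List.append_of_mem (hk.mem_iff.2 hs)
      exact ⟨b ++ a, CoxeterEquiv.rotate_append a (s :: b)⟩
    obtain ⟨m, hm⟩ := key l (List.Perm.refl _)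
    obtain ⟨m', hm'⟩ := key l' hp.symm
    have hlm : l.Perm (s :: m) := hm.perm
    have hmm : m.Perm m' := (hlm.symm.trans (hp.trans hm'.perm)).cons_inv
    have hsm : (s :: m).Nodup := hlm.nodup_iff.1 hnd
    rw [List.nodup_cons] at hsm
    have hlen : m.length = n := by have := hlm.length_eq; simp at this; omega
    have hne : ∀ a ∈ m, a ∈ l ∧ a ≠ s := fun a ha =>
      ⟨hlm.mem_iff.2 (by simp [ha]), by rintro rfl; exact hsm.1 ha⟩
    refine (hm.trans _ _ _ ((ih hsm.2 hmm hlen).cons_leaf hsm.2 ?_)).trans _ _ _ hm'.symm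
    intro a ha b hb h1 h2
    exact hleaf a (hne a ha).1 b (hne b hb).1 (hne a ha).2 (hne b hb).2 h1 h2

/-- A forest is bipartite. -/
theorem exists_coloring [Fintype B] (hM : IsForestLike M) :
    ∃ χ : B → Bool, ∀ a b, a ≠ b → χ a = χ b → M a b = 2 := by
  suffices ∀ n (J : Finset B), J.card = n → ∃ χ : B → Bool, ∀ a ∈ J, ∀ b ∈ J, a ≠ b →
      χ a = χ b → M a b = 2 by
    obtain ⟨χ, h⟩ := this _ Finset.univ rfl
    exact ⟨χ, fun a b => h a (Finset.mem_univ _) b (Finset.mem_univ _)⟩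
  intro n
  induction n with
  | zero =>
    intro J hJ
    rw [Finset.card_eq_zero] at hJ
    exact ⟨fun _ => true, by simp [hJ]⟩
  | succ n ih =>
    intro J hJ
    obtain ⟨s, hs, hleaf⟩ := hM J (by rw [← Finset.card_pos]; omega)
    obtain ⟨χ, hχ⟩ := ih (J.erase s) (by rw [Finset.card_erase_of_mem hs]; omega)
    obtain ⟨b₀, hb₀⟩ : ∃ b₀ : Bool, ∀ a ∈ J, a ≠ s → b₀ = χ a → M s a = 2 := by
      by_cases h : ∃ r ∈ J, r ≠ s ∧ M s r ≠ 2
      · obtain ⟨r, hr, hrs, h2⟩ := h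
        refine ⟨!χ r, fun a ha has hc => ?_⟩
        by_contra h2'
        have := hleaf r hr a ha hrs has h2 h2'
        subst this
        simp at hc
      · push Not at h
        exact ⟨true, fun a ha has _ => h a ha has⟩
    refine ⟨Function.update χ s b₀, fun a ha b hb hab hc => ?_⟩
    rcases eq_or_ne a s with rfl | has
    · rw [Function.update_self, Function.update_of_ne hab.symm] at hc
      exact hb₀ b hb hab.symm hc
    · rcases eq_or_ne b s with rfl | hbs
      · rw [Function.update_self, Function.update_of_ne has] at hc
        rw [M.symmetric]
        exact hb₀ a ha has hc.symm
      · rw [Function.update_of_ne has, Function.update_of_ne hbs] at hc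
        exact hχ a (by simp [has, ha]) b (by simp [hbs, hb]) hab hc

theorem isForestLike [Fintype B] [Fintype W] {cs : CoxeterSystem M W} (hirr : IsIrreducibleCS cs) :
    IsForestLike M := by
  intro J hJ
  by_contra! hc
  obtain ⟨s₀, hs₀⟩ := hJ
  let x : B → ℝ := ∑ s ∈ J, simpleRoot s
  have hx (r : B) : x r = if r ∈ J then 1 else 0 := by
    simp [x, simpleRoot, Pi.single_apply]
  have hx0 : x ≠ 0 := fun h => by simpa [hx, hs₀] using congrFun h s₀
  have hpos := form_posDef cs hirr hx0
  have : form M x x ≤ 0 := by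
    rw [form_apply]
    refine Finset.sum_nonpos fun s _ => ?_
    rw [hx]
    split_ifs with hs
    · obtain ⟨a, ha, b, hb, has, hbs, h1, h2, hab⟩ := hc s hs
      have h3 : coroot M s x = ∑ r ∈ J, cartan M s r := by simp [x]
      have hsub : ({s, a, b} : Finset B) ⊆ J := by
        intro r; simp only [Finset.mem_insert, Finset.mem_singleton]
        rintro (rfl | rfl | rfl) <;> assumption
      have h4 : ∑ r ∈ J, cartan M s r ≤ ∑ r ∈ ({s, a, b} : Finset B), cartan M s r := by
        rw [← Finset.sum_sdiff hsub, add_le_iff_nonpos_left]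
        refine Finset.sum_nonpos fun r hr => cartan_nonpos ?_
        rintro rfl
        simp at hr
      rw [Finset.sum_insert (by simp [has.symm, hbs.symm]), Finset.sum_pair hab, cartan_self] at h4
      have := cartan_le_neg_one has.symm h1
      have := cartan_le_neg_one hbs.symm h2
      linarith
    · simp
  linarith

end

section

/-- The solution of `u (k + 2) = lam * u (k + 1) - u k` with `u 0 = 0` and `u 1 = 1`. -/
noncomputable def recSol (lam : ℝ) : ℕ → ℝ
  | 0 => 0
  | 1 => 1
  | k + 2 => lam * recSol lam (k + 1) - recSol lam k

lemma recSol_add_two (lam : ℝ) (k : ℕ) :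
    recSol lam (k + 2) = lam * recSol lam (k + 1) - recSol lam k := rfl

/-- `f` satisfies the recursion `f (k + 2) = lam * f (k + 1) - f k`. -/
def IsRec (lam : ℝ) (f : ℕ → ℝ) : Prop := ∀ k, f (k + 2) = lam * f (k + 1) - f k

variable {lam : ℝ} {f g : ℕ → ℝ}

lemma isRec_recSol : IsRec lam (recSol lam) := fun k => recSol_add_two lam k

lemma IsRec.shift (hf : IsRec lam f) (a : ℕ) : IsRec lam fun k => f (a + k) :=
  fun k => hf (a + k)

lemma IsRec.const_mul (hf : IsRec lam f) (c : ℝ) : IsRec lam fun k => c * f k := fun k => by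
  simp only [hf k]; ring

lemma IsRec.ext (hf : IsRec lam f) (hg : IsRec lam g) (h0 : f 0 = g 0) (h1 : f 1 = g 1) (k : ℕ) :
    f k = g k := by
  suffices f k = g k ∧ f (k + 1) = g (k + 1) from this.1
  induction k with
  | zero => exact ⟨h0, h1⟩
  | succ k ih => exact ⟨ih.2, by rw [hf, hg, ih.1, ih.2]⟩

lemma IsRec.eq_mul_recSol (hf : IsRec lam f) {a : ℕ} (ha : f a = 0) (k : ℕ) :
    f (a + k) = f (a + 1) * recSol lam k :=
  (hf.shift a).ext (isRec_recSol.const_mul _) (by simp [ha, recSol]) (by simp [recSol]) k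

lemma recSol_add {m : ℕ} (hm : recSol lam m = 0) (k : ℕ) :
    recSol lam (m + k) = recSol lam (m + 1) * recSol lam k := isRec_recSol.eq_mul_recSol hm k

/-- Before its first positive zero, the solution is positive. -/
lemma recSol_pos (hnn : ∀ k, 0 ≤ recSol lam k * recSol lam (k + 1)) {m : ℕ}
    (hmin : ∀ k, 0 < k → k < m → recSol lam k ≠ 0) {k : ℕ} (hk : 0 < k) (hkm : k < m) :
    0 < recSol lam k := by
  induction k with
  | zero => omega
  | succ k ih =>
    rcases Nat.eq_zero_or_pos k with rfl | hk0
    · simp [recSol]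
    · have h1 := ih hk0 (by omega)
      exact lt_of_le_of_ne (nonneg_of_mul_nonneg_right (hnn k) h1) (hmin _ hk hkm).symm

lemma recSol_succ_neg (hnn : ∀ k, 0 ≤ recSol lam k * recSol lam (k + 1)) {m : ℕ} (hm0 : 0 < m)
    (hm : recSol lam m = 0) (hmin : ∀ k, 0 < k → k < m → recSol lam k ≠ 0) :
    recSol lam (m + 1) < 0 := by
  have h1 : m ≠ 1 := by rintro rfl; simp [recSol] at hm
  obtain ⟨k, rfl⟩ : ∃ k, m = k + 2 := ⟨m - 2, by omega⟩
  have := recSol_pos hnn hmin (k := k + 1) (by omega) (by omega)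
  rw [show k + 2 + 1 = (k + 1) + 2 by ring, recSol_add_two, show k + 1 + 1 = k + 2 by ring, hm]
  linarith

/-- Shifting by a zero `m` of `recSol` scales every solution of the recursion. -/
lemma IsRec.add_firstZero (hf : IsRec lam f) {m : ℕ} (hm : recSol lam m = 0) (k : ℕ) :
    f (m + k) = recSol lam (m + 1) * f k := by
  have key : ∀ k, f k = f 1 * recSol lam k - f 0 * (lam * recSol lam k - recSol lam (k + 1)) :=
    hf.ext (fun k => by
      have e1 := recSol_add_two lam k
      have e2 := recSol_add_two lam (k + 1)
      rw [show k + 2 + 1 = k + 1 + 2 by ring, e2, e1]; ring) (by simp [recSol]) (by simp [recSol])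
  refine (hf.shift m).ext (hf.const_mul _) ?_ ?_ k
  · rw [add_zero, key m, hm]; ring
  · rw [key (m + 1), recSol_add_two, hm]; ring

/-- Zeros come exactly once in every period of length `m`, the first positive zero of `recSol`. -/
lemma IsRec.existsUnique_zero (hf : IsRec lam f) (hne : ∀ k, f k ≠ 0 ∨ f (k + 1) ≠ 0)
    (hfnn : ∀ k, 0 ≤ f k * f (k + 1))
    (hnn : ∀ k, 0 ≤ recSol lam k * recSol lam (k + 1)) {m : ℕ} (hm0 : 0 < m)
    (hm : recSol lam m = 0) (hmin : ∀ k, 0 < k → k < m → recSol lam k ≠ 0) :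
    ∃! k, k < m ∧ f k = 0 := by
  have hneg := recSol_succ_neg hnn hm0 hm hmin
  have hshift : f (m + 0) = recSol lam (m + 1) * f 0 := hf.add_firstZero hm 0
  rw [add_zero] at hshift
  have hex : ∃ k, k < m ∧ f k = 0 := by
    by_contra! hc
    have hsame : ∀ k, k < m → 0 < f 0 * f k := by
      intro k hk
      induction k with
      | zero => exact mul_self_pos.2 (hc 0 hk)
      | succ k ih =>
        have h1 := ih (by omega)
        have h2 : 0 < f k * f (k + 1) :=
          lt_of_le_of_ne (hfnn k) (mul_ne_zero (hc k (by omega)) (hc _ hk)).symm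
        have h3 : 0 < (f 0 * f (k + 1)) * (f k) ^ 2 := by nlinarith
        exact pos_of_mul_pos_left h3 (sq_nonneg _)
    obtain ⟨k, rfl⟩ : ∃ k, m = k + 1 := ⟨m - 1, by omega⟩
    have h1 := hsame k (by omega)
    have h2 := hfnn k
    rw [hshift] at h2
    nlinarith
  obtain ⟨k, hk, hfk⟩ := hex
  have hlt : ∀ a b, a < b → b < m → f a = 0 → f b ≠ 0 := by
    intro a b hab hb ha
    obtain ⟨d, rfl⟩ := Nat.exists_eq_add_of_lt hab
    rw [show a + d + 1 = a + (d + 1) by ring, hf.eq_mul_recSol ha]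
    exact mul_ne_zero ((hne a).resolve_left (by simp [ha])) (hmin _ (by omega) (by omega))
  refine ⟨k, ⟨hk, hfk⟩, fun k' ⟨hk', hfk'⟩ => ?_⟩
  rcases lt_trichotomy k k' with h | h | h
  · exact absurd hfk' (hlt _ _ h hk' hfk)
  · exact h.symm
  · exact absurd hfk (hlt _ _ h hk hfk')

/-- The zeros of `recSol` are the multiples of the first positive zero; if the solution is periodic
with even period `2 * h`, then that first zero divides `h`. -/
lemma firstZero_dvd (hnn : ∀ k, 0 ≤ recSol lam k * recSol lam (k + 1)) {m : ℕ} (hm0 : 0 < m)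
    (hm : recSol lam m = 0) (hmin : ∀ k, 0 < k → k < m → recSol lam k ≠ 0) {h : ℕ}
    (hper : ∀ k, recSol lam (2 * h + k) = recSol lam k) : m ∣ h := by
  have hneg := recSol_succ_neg hnn hm0 hm hmin
  have hpow (a k : ℕ) : recSol lam (m * a + k) = recSol lam (m + 1) ^ a * recSol lam k := by
    induction a with
    | zero => simp
    | succ a ih => rw [show m * (a + 1) + k = m + (m * a + k) by ring, recSol_add hm, ih]; ring
  have hdvd : m ∣ 2 * h := by
    have h0 := hper 0
    rw [add_zero] at h0
    rw [← Nat.div_add_mod (2 * h) m, hpow] at h0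
    have h1 : recSol lam (2 * h % m) = 0 := by
      have hz : recSol lam 0 = 0 := rfl
      rw [hz] at h0
      exact (mul_eq_zero.1 h0).resolve_left (pow_ne_zero _ hneg.ne)
    rw [Nat.dvd_iff_mod_eq_zero]
    by_contra hc
    exact hmin _ (Nat.pos_of_ne_zero hc) (Nat.mod_lt _ hm0) h1
  obtain ⟨a, ha⟩ := hdvd
  have h1 := hper 1
  rw [ha, hpow] at h1
  have hu : recSol lam 1 = 1 := rfl
  rw [hu, mul_one] at h1
  have hev : Even a := by
    by_contra hodd
    rw [Nat.not_even_iff_odd] at hodd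
    have := hodd.pow_neg hneg
    linarith
  obtain ⟨b, rfl⟩ := hev
  exact ⟨b, by nlinarith⟩

end

section

variable {B W : Type*} [Fintype B] [DecidableEq B] [Group W] {M : CoxeterMatrix B}

omit [DecidableEq B] in
lemma form_abs_le (x : B → ℝ) : form M |x| |x| ≤ form M x x := by
  simp only [form_apply, coroot_apply, Finset.mul_sum, Pi.abs_apply]
  refine Finset.sum_le_sum fun s _ => Finset.sum_le_sum fun r _ => ?_
  rcases eq_or_ne s r with rfl | h
  · rw [mul_left_comm, abs_mul_abs_self, mul_left_comm]
  · have h1 := cartan_nonpos (M := M) h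
    have h2 : x s * x r ≤ |x s| * |x r| := by rw [← abs_mul]; exact le_abs_self _
    nlinarith

/-- Over the reals, a quadratic polynomial `2 * t * b + t ^ 2 * q` without constant term is
nonnegative only if its linear term vanishes. -/
lemma eq_zero_of_forall_quadratic_nonneg {b q : ℝ} (h : ∀ t : ℝ, 0 ≤ 2 * t * b + t ^ 2 * q) :
    b = 0 := by
  by_contra hb
  have h1 := h (-b / (|q| + 1))
  have hq : 0 < |q| + 1 := by positivity
  have h2 : 2 * (-b / (|q| + 1)) * b + (-b / (|q| + 1)) ^ 2 * q =
      b ^ 2 / (|q| + 1) ^ 2 * (q - 2 * (|q| + 1)) := by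
    field_simp; ring
  rw [h2] at h1
  have h3 : 0 < b ^ 2 / (|q| + 1) ^ 2 := by positivity
  have h4 := le_abs_self q
  have h5 := abs_nonneg q
  nlinarith

/-- The Cartan matrix of an irreducible Coxeter system has a positive eigenvector. -/
theorem exists_positive_eigenvector {cs : CoxeterSystem M W} (hirr : IsIrreducibleCS cs) :
    ∃ (v : B → ℝ) (lam : ℝ), (∀ s, 0 < v s) ∧ ∀ s, coroot M s v = (2 - lam) * v s := by
  obtain ⟨s₀⟩ := hirr.1
  let K : Set (B → ℝ) := {x | ∑ s, x s * x s = 1}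
  have hK : IsCompact K := by
    refine Metric.isCompact_of_isClosed_isBounded ?_ ?_
    · exact isClosed_eq (by fun_prop) continuous_const
    · refine (Metric.isBounded_closedBall (x := (0 : B → ℝ)) (r := 1)).subset fun x hx => ?_
      rw [mem_closedBall_zero_iff, pi_norm_le_iff_of_nonneg zero_le_one]
      intro s
      have h1 : x s * x s ≤ 1 := by
        rw [← show ∑ s, x s * x s = 1 from hx]
        exact Finset.single_le_sum (f := fun s => x s * x s)
          (fun r _ => mul_self_nonneg (x r)) (Finset.mem_univ s)
      rw [Real.norm_eq_abs]
      exact abs_le_one_iff_mul_self_le_one.2 h1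
  have hne : K.Nonempty := ⟨simpleRoot s₀, by simp [K, simpleRoot, Pi.single_apply]⟩
  have hcont : ContinuousOn (fun x : B → ℝ => form M x x) K := by
    simp only [form_apply, coroot_apply]
    fun_prop
  obtain ⟨x, hxK, hmin⟩ := hK.exists_isMinOn hne hcont
  set v : B → ℝ := |x| with hv
  have hvK : ∑ s, v s * v s = 1 := by
    rw [← show ∑ s, x s * x s = 1 from hxK]
    simp [hv]
  set μ := form M v v with hμ
  have hbound (y : B → ℝ) : μ * ∑ s, y s * y s ≤ form M y y := by
    rcases eq_or_ne y 0 with rfl | hy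
    · simp
    have hpos : 0 < ∑ s, y s * y s := by
      obtain ⟨s, hs⟩ := Function.ne_iff.1 hy
      exact Finset.sum_pos' (fun s _ => mul_self_nonneg _) ⟨s, Finset.mem_univ s, mul_self_pos.2 hs⟩
    set n := ∑ s, y s * y s
    have hsq : √n * √n = n := Real.mul_self_sqrt hpos.le
    have hsn : √n ≠ 0 := (Real.sqrt_pos.2 hpos).ne'
    have hz : ((√n)⁻¹ • y) ∈ K := by
      change ∑ s, ((√n)⁻¹ • y) s * ((√n)⁻¹ • y) s = 1
      simp only [Pi.smul_apply, smul_eq_mul]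
      rw [Finset.sum_congr rfl fun s _ => (by ring : (√n)⁻¹ * y s * ((√n)⁻¹ * y s) =
        (√n * √n)⁻¹ * (y s * y s)), ← Finset.mul_sum, hsq]
      exact inv_mul_cancel₀ hpos.ne'
    have h1 : μ ≤ form M ((√n)⁻¹ • y) ((√n)⁻¹ • y) := (form_abs_le x).trans (hmin hz)
    simp only [map_smul, LinearMap.smul_apply, smul_eq_mul] at h1
    have h2 : (√n)⁻¹ * ((√n)⁻¹ * form M y y) = form M y y / n := by
      rw [div_eq_inv_mul, ← mul_assoc, ← mul_inv, hsq]
    rw [h2, le_div_iff₀ hpos] at h1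
    exact h1
  have heig (s : B) : coroot M s v = μ * v s := by
    refine sub_eq_zero.1 (eq_zero_of_forall_quadratic_nonneg (q := 2 - μ) fun t => ?_)
    have h1 := hbound (v + t • simpleRoot s)
    have h2 : ∑ r, (v + t • simpleRoot s) r * (v + t • simpleRoot s) r =
        1 + 2 * t * v s + t ^ 2 := by
      have (r : B) : (v + t • simpleRoot s) r * (v + t • simpleRoot s) r =
          v r * v r + (if r = s then 2 * t * v s + t ^ 2 else 0) := by
        by_cases hr : r = s
        · subst hr; simp [simpleRoot_self]; ring
        · simp [simpleRoot_of_ne hr, hr]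
      simp only [this, Finset.sum_add_distrib, hvK, Finset.sum_ite_eq', Finset.mem_univ, if_true]
      ring
    have h3 : form M (v + t • simpleRoot s) (v + t • simpleRoot s) =
        μ + 2 * t * coroot M s v + 2 * t ^ 2 := by
      simp only [map_add, map_smul, LinearMap.add_apply, LinearMap.smul_apply, smul_eq_mul,
        form_simpleRoot_left, form_simpleRoot_right, coroot_simpleRoot, cartan_self, ← hμ]
      ring
    rw [h2, h3] at h1
    linarith
  have hnn (s : B) : 0 ≤ v s := abs_nonneg _
  refine ⟨v, 2 - μ, fun s => (hnn s).lt_of_ne' fun hs => ?_, fun s => by rw [heig]; ring⟩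
  have hall : ∀ r, v r = 0 := by
    refine irreducible_induction cs hirr (fun r => v r = 0) hs fun a b ha hab hM => ?_
    have h1 := heig a
    rw [ha, mul_zero, coroot_apply] at h1
    have h2 := (Finset.sum_eq_zero_iff_of_nonpos fun r _ => ?_).1 h1 b (Finset.mem_univ b)
    · have h3 := cartan_le_neg_one hab hM
      exact (mul_eq_zero.1 h2).resolve_left (by linarith)
    · rcases eq_or_ne a r with rfl | har
      · simp [ha]
      · exact mul_nonpos_of_nonpos_of_nonneg (cartan_nonpos har) (hnn r)
  simp [hall] at hvK

end

section

variable {B W : Type*} [Fintype B] [DecidableEq B] [Group W] {M : CoxeterMatrix B}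

/-- `χ` is a proper 2-coloring of the Coxeter graph: letters of the same color commute. -/
def IsColoring (M : CoxeterMatrix B) (χ : B → Bool) : Prop :=
  ∀ a b, a ≠ b → χ a = χ b → M a b = 2

/-- The letters of a given color. -/
noncomputable def colorClass (χ : B → Bool) (b : Bool) : List B :=
  (Finset.univ.filter fun s => χ s = b).toList

/-- The product of the simple reflections of a given color. -/
noncomputable def colorProd (cs : CoxeterSystem M W) (χ : B → Bool) (b : Bool) : W :=
  cs.wordProd (colorClass χ b)

omit [DecidableEq B] in
lemma mem_colorClass {χ : B → Bool} {b : Bool} {s : B} : s ∈ colorClass χ b ↔ χ s = b := by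
  simp [colorClass]

omit [DecidableEq B] in
lemma nodup_colorClass (χ : B → Bool) (b : Bool) : (colorClass χ b).Nodup :=
  Finset.nodup_toList _

/-- The part of the linear functional with coefficients `v` supported on the given color. -/
noncomputable def colorSum (χ : B → Bool) (v : B → ℝ) (b : Bool) (x : B → ℝ) : ℝ :=
  ∑ s, if χ s = b then v s * x s else 0

variable (cs : CoxeterSystem M W)

lemma rep_wordProd_of_commuting {l : List B} (hl : l.Nodup)
    (hcomm : ∀ a ∈ l, ∀ b ∈ l, a ≠ b → M a b = 2) (x : B → ℝ) (r : B) :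
    rep cs (cs.wordProd l) x r = x r - if r ∈ l then coroot M r x else 0 := by
  induction l generalizing r with
  | nil => simp
  | cons s l ih =>
    rw [List.nodup_cons] at hl
    have ih := ih hl.2 fun a ha b hb => hcomm a (by simp [ha]) b (by simp [hb])
    have hs : coroot M s (rep cs (cs.wordProd l) x) = coroot M s x := by
      rw [coroot_apply, coroot_apply]
      refine Finset.sum_congr rfl fun r _ => ?_
      by_cases hr : r ∈ l
      · rw [cartan_of_eq_two (hcomm s (by simp) r (by simp [hr]) (by rintro rfl; exact hl.1 hr))]
        simp
      · rw [ih, if_neg hr, sub_zero]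
    rw [cs.wordProd_cons, rep_mul_apply, rep_simple, sigma_apply, hs, Pi.sub_apply, Pi.smul_apply,
      smul_eq_mul, ih]
    by_cases hrs : r = s
    · subst hrs
      simp [hl.1, simpleRoot_self]
    · simp [hrs, simpleRoot_of_ne hrs]

section coloring

variable {χ : B → Bool} (hχ : IsColoring M χ)
include hχ

lemma rep_colorProd_apply (b : Bool) (x : B → ℝ) (r : B) :
    rep cs (colorProd cs χ b) x r = x r - if χ r = b then coroot M r x else 0 := by
  rw [colorProd, rep_wordProd_of_commuting cs (nodup_colorClass χ b)]
  · simp only [mem_colorClass]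
  · intro a ha c hc hac
    rw [mem_colorClass] at ha hc
    exact hχ a c hac (ha.trans hc.symm)

lemma colorSum_rep_colorProd_not (v : B → ℝ) (b : Bool) (x : B → ℝ) :
    colorSum χ v (!b) (rep cs (colorProd cs χ b) x) = colorSum χ v (!b) x := by
  refine Finset.sum_congr rfl fun s _ => ?_
  rw [rep_colorProd_apply cs hχ]
  cases hs : χ s <;> cases b <;> simp

omit [DecidableEq B] in
lemma coroot_colored (v : B → ℝ) (r : B) :
    coroot M r (fun s => if χ s = χ r then v s else 0) = 2 * v r := by
  rw [coroot_apply, Finset.sum_eq_single r]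
  · simp [cartan_self]
  · intro s _ hs
    by_cases h : χ s = χ r
    · rw [cartan_of_eq_two (hχ r s hs.symm h.symm), zero_mul]
    · simp [h]
  · simp

lemma colorSum_rep_colorProd {v : B → ℝ} {lam : ℝ}
    (heig : ∀ s, coroot M s v = (2 - lam) * v s) (b : Bool) (x : B → ℝ) :
    colorSum χ v b (rep cs (colorProd cs χ b) x) =
      lam * colorSum χ v (!b) x - colorSum χ v b x := by
  have h1 : colorSum χ v b (rep cs (colorProd cs χ b) x) =
      colorSum χ v b x - form M (fun s => if χ s = b then v s else 0) x := by
    rw [form_apply, colorSum, colorSum, ← Finset.sum_sub_distrib]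
    refine Finset.sum_congr rfl fun s _ => ?_
    rw [rep_colorProd_apply cs hχ]
    split_ifs <;> ring
  have h2 (r : B) : coroot M r (fun s => if χ s = b then v s else 0) =
      if χ r = b then 2 * v r else - lam * v r := by
    split_ifs with hr
    · rw [← hr, coroot_colored hχ]
    · have h3 : (fun s => if χ s = b then v s else 0) =
          v - fun s => if χ s = χ r then v s else 0 := by
        ext s
        cases hs : χ s <;> cases hr' : χ r <;> cases b <;> simp_all
      rw [h3, map_sub, heig, coroot_colored hχ]
      ring
  rw [h1, form_comm, form_apply]
  simp only [h2, colorSum, Finset.mul_sum, ← Finset.sum_sub_distrib]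
  refine Finset.sum_congr rfl fun s _ => ?_
  cases hs : χ s <;> cases b <;> simp <;> ring

end coloring

/-- The color used at the `k`-th step, alternating and starting with `true`. -/
def stepColor (k : ℕ) : Bool := k % 2 == 0

lemma stepColor_zero : stepColor 0 = true := rfl

lemma stepColor_succ (k : ℕ) : stepColor (k + 1) = !stepColor k := by
  rcases Nat.mod_two_eq_zero_or_one k with h | h <;> simp [stepColor, h, Nat.add_mod]

lemma stepColor_two_mul_add (n k : ℕ) : stepColor (2 * n + k) = stepColor k := by
  simp [stepColor]

/-- The alternating products `1, c₊, c₋ c₊, c₊ c₋ c₊, …`. -/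
noncomputable def halfPow (cs : CoxeterSystem M W) (χ : B → Bool) : ℕ → W
  | 0 => 1
  | k + 1 => colorProd cs χ (stepColor k) * halfPow cs χ k

/-- The bipartite Coxeter element. -/
noncomputable def bipartite (cs : CoxeterSystem M W) (χ : B → Bool) : W :=
  colorProd cs χ true * colorProd cs χ false

/-- The values of the two halves of the functional along the orbit of `x`. -/
noncomputable def orbitSeq (cs : CoxeterSystem M W) (χ : B → Bool) (v x : B → ℝ) (k : ℕ) : ℝ :=
  colorSum χ v (stepColor k) (rep cs (halfPow cs χ k) x)

section orbit

variable {χ : B → Bool} (hχ : IsColoring M χ)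
include hχ

omit [DecidableEq B] [Fintype B] in
lemma commute_wordProd {s : B} {l : List B} (hl : ∀ a ∈ l, χ a = χ s) :
    Commute (cs.simple s) (cs.wordProd l) := by
  induction l with
  | nil => simp
  | cons a l ih =>
    rw [cs.wordProd_cons]
    refine Commute.mul_right ?_ (ih fun b hb => hl b (by simp [hb]))
    rcases eq_or_ne s a with rfl | h
    · exact Commute.refl _
    · exact commute_of_eq_two cs (hχ s a h (hl a (by simp)).symm)

omit [DecidableEq B] in
lemma commute_colorProd (s : B) : Commute (cs.simple s) (colorProd cs χ (χ s)) :=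
  commute_wordProd cs hχ fun _ ha => mem_colorClass.1 ha

omit [DecidableEq B] in
lemma colorProd_mul_self (b : Bool) : colorProd cs χ b * colorProd cs χ b = 1 := by
  suffices ∀ l : List B, (∀ a ∈ l, χ a = b) → cs.wordProd l * cs.wordProd l = 1 from
    this _ fun a ha => mem_colorClass.1 ha
  intro l hl
  induction l with
  | nil => simp
  | cons s l ih =>
    have hcomm : Commute (cs.simple s) (cs.wordProd l) :=
      commute_wordProd cs hχ fun a ha => by rw [hl a (by simp [ha]), hl s (by simp)]
    have ih := ih fun b hb => hl b (by simp [hb])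
    rw [cs.wordProd_cons, mul_assoc, ← mul_assoc (cs.wordProd l), ← hcomm.eq, mul_assoc, ih,
      mul_one, cs.simple_mul_simple_self]

omit [DecidableEq B] in
lemma bipartite_inv : (bipartite cs χ)⁻¹ = colorProd cs χ false * colorProd cs χ true := by
  rw [bipartite, mul_inv_rev, inv_eq_of_mul_eq_one_right (colorProd_mul_self cs hχ _),
    inv_eq_of_mul_eq_one_right (colorProd_mul_self cs hχ _)]

omit [DecidableEq B] in
lemma halfPow_two_mul_add (n k : ℕ) :
    halfPow cs χ (2 * n + k) = halfPow cs χ k * (bipartite cs χ)⁻¹ ^ n := by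
  induction k with
  | zero =>
    simp only [add_zero, halfPow, one_mul]
    induction n with
    | zero => simp [halfPow]
    | succ n ih =>
      rw [show 2 * (n + 1) = 2 * n + 1 + 1 by ring, halfPow, halfPow, ih,
        stepColor_succ, show stepColor (2 * n) = true from stepColor_two_mul_add n 0, pow_succ',
        bipartite_inv cs hχ, Bool.not_true, mul_assoc]
  | succ k ih =>
    rw [← add_assoc, halfPow, ih, stepColor_two_mul_add, halfPow, mul_assoc]

lemma orbitSeq_succ (v x : B → ℝ) (k : ℕ) :
    orbitSeq cs χ v x (k + 1) = colorSum χ v (!stepColor k) (rep cs (halfPow cs χ k) x) := by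
  rw [orbitSeq, stepColor_succ, halfPow, rep_mul_apply, colorSum_rep_colorProd_not cs hχ]

lemma isRec_orbitSeq {v : B → ℝ} {lam : ℝ} (heig : ∀ s, coroot M s v = (2 - lam) * v s)
    (x : B → ℝ) : IsRec lam (orbitSeq cs χ v x) := by
  intro k
  rw [orbitSeq_succ cs hχ, orbitSeq_succ cs hχ, halfPow, stepColor_succ, Bool.not_not,
    rep_mul_apply, colorSum_rep_colorProd cs hχ heig, orbitSeq]

lemma orbitSeq_two_mul_add (v x : B → ℝ) (n k : ℕ) :
    orbitSeq cs χ v x (2 * n + k) = orbitSeq cs χ v (rep cs ((bipartite cs χ)⁻¹ ^ n) x) k := by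
  rw [orbitSeq, orbitSeq, stepColor_two_mul_add, halfPow_two_mul_add cs hχ, rep_mul_apply]

end orbit

end

section

variable {B W : Type*} [Fintype B] [DecidableEq B] [Group W] {M : CoxeterMatrix B}

section colorSum

variable {χ : B → Bool} {v : B → ℝ}

omit [DecidableEq B] in
lemma colorSum_add_not (b : Bool) (x : B → ℝ) :
    colorSum χ v b x + colorSum χ v (!b) x = ∑ s, v s * x s := by
  rw [colorSum, colorSum, ← Finset.sum_add_distrib]
  refine Finset.sum_congr rfl fun s _ => ?_
  cases hs : χ s <;> cases b <;> simp

omit [DecidableEq B] in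
lemma colorSum_neg (b : Bool) (x : B → ℝ) : colorSum χ v b (-x) = - colorSum χ v b x := by
  simp only [colorSum, ← Finset.sum_neg_distrib]
  refine Finset.sum_congr rfl fun s _ => ?_
  split_ifs <;> simp

lemma colorSum_simpleRoot (b : Bool) (s : B) :
    colorSum χ v b (simpleRoot s) = if χ s = b then v s else 0 := by
  rw [colorSum, Finset.sum_eq_single s]
  · simp [simpleRoot_self]
  · intro r _ hr
    simp [simpleRoot_of_ne hr]
  · simp

variable (hv : ∀ s, 0 < v s)
include hv

omit [DecidableEq B] in
lemma colorSum_nonneg (b : Bool) {x : B → ℝ} (hx : 0 ≤ x) : 0 ≤ colorSum χ v b x := by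
  refine Finset.sum_nonneg fun s _ => ?_
  have := hx s
  split_ifs
  · exact mul_nonneg (hv s).le this
  · exact le_rfl

omit [DecidableEq B] in
lemma apply_eq_zero_of_colorSum_eq_zero {b : Bool} {x : B → ℝ} (hx : 0 ≤ x ∨ x ≤ 0)
    (h : colorSum χ v b x = 0) {s : B} (hs : χ s = b) : x s = 0 := by
  wlog hx0 : 0 ≤ x generalizing x
  · have := this (x := -x) (by rcases hx with h | h <;> simp [h])
      (by rw [colorSum_neg, h, neg_zero])
      (neg_nonneg.2 (hx.resolve_left hx0))
    simpa using this
  have h1 := (Finset.sum_eq_zero_iff_of_nonneg fun r _ => ?_).1 h s (Finset.mem_univ s)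
  · rw [if_pos hs] at h1
    exact (mul_eq_zero.1 h1).resolve_left (hv s).ne'
  · have := hx0 r
    split_ifs
    · exact mul_nonneg (hv r).le this
    · exact le_rfl

end colorSum

variable {cs : CoxeterSystem M W} [Fintype W] (hirr : IsIrreducibleCS cs)

omit [Fintype W] in
lemma IsRootOf.apply_eq_zero_of_ne {s r : B} {β : B → ℝ} (h : IsRootOf cs (cs.simple s) β)
    (hr : r ≠ s) : β r = 0 := by
  have h1 := h.rep_apply β
  rw [h.form_self, rep_simple] at h1
  have h2 := congrFun h1 r
  rw [sigma_apply_of_ne hr] at h2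
  simp only [Pi.sub_apply, Pi.smul_apply, smul_eq_mul] at h2
  linarith

variable {χ : B → Bool} (hχ : IsColoring M χ) {v : B → ℝ} (hv : ∀ s, 0 < v s)
include hirr hχ

/-- A reflection whose root is supported on one color is simple. -/
lemma IsRootOf.exists_eq_simple_of_color {t : W} {β : B → ℝ} (h : IsRootOf cs t β) {b : Bool}
    (hb : ∀ r, χ r = b → β r = 0) : ∃ s, χ s = !b ∧ t = cs.simple s := by
  obtain ⟨g, hg, s, hs, rfl⟩ := h.exists_conj_of_support hirr (J := {s | χ s = !b}) fun r hr =>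
    hb r (by simpa using hr)
  refine ⟨s, hs, ?_⟩
  have hcomm : Commute g (cs.simple s) := by
    clear h
    induction hg using Subgroup.closure_induction with
    | mem x hx =>
      obtain ⟨r, hr, rfl⟩ := hx
      rcases eq_or_ne r s with rfl | hrs
      · exact Commute.refl _
      · exact commute_of_eq_two cs (hχ r s hrs (Eq.trans hr (Eq.symm hs)))
    | one => exact Commute.one_left _
    | mul x y _ _ hx hy => exact hx.mul_left hy
    | inv x _ hx => exact hx.inv_left
  rw [hcomm.eq, mul_inv_cancel_right]

include hv

lemma orbitSeq_mul_nonneg {t : W} {β : B → ℝ} (h : IsRootOf cs t β) (k : ℕ) :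
    0 ≤ orbitSeq cs χ v β k * orbitSeq cs χ v β (k + 1) := by
  rw [orbitSeq_succ cs hχ, orbitSeq]
  rcases (h.conj (halfPow cs χ k)).nonneg_or_nonpos hirr with h | h
  · exact mul_nonneg (colorSum_nonneg hv _ h) (colorSum_nonneg hv _ h)
  · have h1 := colorSum_nonneg (χ := χ) hv (stepColor k) (neg_nonneg.2 h)
    have h2 := colorSum_nonneg (χ := χ) hv (!stepColor k) (neg_nonneg.2 h)
    rw [colorSum_neg] at h1 h2
    nlinarith

lemma orbitSeq_ne_zero_or {t : W} {β : B → ℝ} (h : IsRootOf cs t β) (k : ℕ) :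
    orbitSeq cs χ v β k ≠ 0 ∨ orbitSeq cs χ v β (k + 1) ≠ 0 := by
  rw [orbitSeq_succ cs hχ, orbitSeq]
  by_contra! hc
  have hsign := (h.conj (halfPow cs χ k)).nonneg_or_nonpos hirr
  refine (h.conj (halfPow cs χ k)).ne_zero (funext fun s => ?_)
  by_cases hs : χ s = stepColor k
  · exact apply_eq_zero_of_colorSum_eq_zero hv hsign hc.1 hs
  · exact apply_eq_zero_of_colorSum_eq_zero hv hsign hc.2 (Bool.eq_not.2 hs)

lemma orbitSeq_eq_zero_iff {t : W} {β : B → ℝ} (h : IsRootOf cs t β) (k : ℕ) :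
    orbitSeq cs χ v β k = 0 ↔
      ∃ s, χ s = (!stepColor k) ∧ halfPow cs χ k * t * (halfPow cs χ k)⁻¹ = cs.simple s := by
  have hγ := h.conj (halfPow cs χ k)
  constructor
  · intro h0
    exact hγ.exists_eq_simple_of_color hirr hχ fun r hr =>
      apply_eq_zero_of_colorSum_eq_zero hv (hγ.nonneg_or_nonpos hirr) h0 hr
  · rintro ⟨s, hs, hts⟩
    rw [hts] at hγ
    refine Finset.sum_eq_zero fun r _ => ?_
    split_ifs with hr
    · rw [hγ.apply_eq_zero_of_ne (by rintro rfl; simp [hr] at hs), mul_zero]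
    · rfl

variable {lam : ℝ} (heig : ∀ s, coroot M s v = (2 - lam) * v s)
include heig

omit [Fintype W] in
/-- The universal solution of the recursion is visible in the orbit of a simple root. -/
lemma exists_orbitSeq_eq_mul_recSol : ∃ (s : B) (a : ℕ) (C : ℝ), C ≠ 0 ∧
    ∀ k, orbitSeq cs χ v (simpleRoot s) (a + k) = C * recSol lam k := by
  obtain ⟨s⟩ := hirr.1
  have hrec := isRec_orbitSeq cs hχ heig (simpleRoot s)
  have h0 : orbitSeq cs χ v (simpleRoot s) 0 = if χ s = true then v s else 0 := by
    rw [orbitSeq, stepColor_zero, halfPow, map_one, Module.End.one_apply, colorSum_simpleRoot]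
  have h1 : orbitSeq cs χ v (simpleRoot s) 1 = if χ s = false then v s else 0 := by
    rw [orbitSeq_succ cs hχ _ _ 0, stepColor_zero, halfPow, map_one, Module.End.one_apply,
      colorSum_simpleRoot, Bool.not_true]
  cases hs : χ s
  · refine ⟨s, 0, v s, (hv s).ne', fun k => ?_⟩
    rw [hrec.eq_mul_recSol (a := 0) (by simp [h0, hs]), zero_add, h1, if_pos hs]
  · refine ⟨s, 1, -v s, neg_ne_zero.2 (hv s).ne', fun k => ?_⟩
    have h2 : orbitSeq cs χ v (simpleRoot s) 1 = 0 := by simp [h1, hs]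
    rw [hrec.eq_mul_recSol h2, hrec 0, zero_add, h2, h0, if_pos hs]
    ring

lemma recSol_mul_nonneg (k : ℕ) : 0 ≤ recSol lam k * recSol lam (k + 1) := by
  obtain ⟨s, a, C, hC, h⟩ := exists_orbitSeq_eq_mul_recSol hirr hχ hv heig
  have h1 := orbitSeq_mul_nonneg hirr hχ hv (t := cs.simple s) (β := simpleRoot s)
    ⟨1, s, by simp, by simp⟩ (a + k)
  rw [add_assoc, h, h] at h1
  have h2 : 0 < C ^ 2 := by positivity
  exact nonneg_of_mul_nonneg_right (a := C ^ 2) (by linarith) h2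

/-- The order of the bipartite Coxeter element is the first positive zero of the recursion. -/
lemma recSol_orderOf_bipartite : 0 < orderOf (bipartite cs χ) ∧
    recSol lam (orderOf (bipartite cs χ)) = 0 ∧
      ∀ k, 0 < k → k < orderOf (bipartite cs χ) → recSol lam k ≠ 0 := by
  set h := orderOf (bipartite cs χ) with hh
  have hpos : 0 < h := orderOf_pos _
  have hnn := recSol_mul_nonneg hirr hχ hv heig
  have hper (k : ℕ) : recSol lam (2 * h + k) = recSol lam k := by
    obtain ⟨s, a, C, hC, hs⟩ := exists_orbitSeq_eq_mul_recSol hirr hχ hv heig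
    refine mul_left_cancel₀ hC ?_
    rw [← hs, ← hs, show a + (2 * h + k) = 2 * h + (a + k) by ring, orbitSeq_two_mul_add cs hχ,
      inv_pow, hh, pow_orderOf_eq_one, inv_one, map_one, Module.End.one_apply]
  have hex : ∃ m, 0 < m ∧ recSol lam m = 0 :=
    ⟨2 * h, by omega, by rw [← add_zero (2 * h), hper]; rfl⟩
  classical
  obtain ⟨m, ⟨hm0, hm⟩, hmin'⟩ : ∃ m, (0 < m ∧ recSol lam m = 0) ∧
      ∀ k < m, ¬ (0 < k ∧ recSol lam k = 0) :=
    ⟨Nat.find hex, Nat.find_spec hex, fun k hk => Nat.find_min hex hk⟩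
  have hmin : ∀ k, 0 < k → k < m → recSol lam k ≠ 0 := fun k hk hkm hz => hmin' k hkm ⟨hk, hz⟩
  have hmh : m ∣ h := firstZero_dvd hnn hm0 hm hmin hper
  have hneg := recSol_succ_neg hnn hm0 hm hmin
  have hone : (bipartite cs χ)⁻¹ ^ m = 1 := by
    refine eq_one_of_functional_scaled cs hirr hv (μ := recSol lam (m + 1) ^ 2)
      (sq_pos_of_neg hneg) fun x => ?_
    have hrec := isRec_orbitSeq cs hχ heig x
    have hkey (k : ℕ) : orbitSeq cs χ v x (2 * m + k) =
        recSol lam (m + 1) ^ 2 * orbitSeq cs χ v x k := by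
      rw [show 2 * m + k = m + (m + k) by ring, hrec.add_firstZero hm, hrec.add_firstZero hm]; ring
    have h0 := hkey 0
    have h1 := hkey 1
    have e0 (y : B → ℝ) : orbitSeq cs χ v y 0 = colorSum χ v true y := by
      rw [orbitSeq, stepColor_zero, halfPow, map_one, Module.End.one_apply]
    have e1 (y : B → ℝ) : orbitSeq cs χ v y 1 = colorSum χ v (!true) y := by
      rw [orbitSeq_succ cs hχ _ _ 0, stepColor_zero, halfPow, map_one, Module.End.one_apply]
    rw [orbitSeq_two_mul_add cs hχ, e0, e0] at h0
    rw [orbitSeq_two_mul_add cs hχ, e1, e1] at h1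
    rw [← colorSum_add_not (χ := χ) true, ← colorSum_add_not (χ := χ) true, h0, h1]
    ring
  have hhm : h ∣ m := orderOf_dvd_of_pow_eq_one (inv_eq_one.1 (by rw [← inv_pow, hone]))
  obtain rfl : m = h := Nat.dvd_antisymm hmh hhm
  exact ⟨hm0, hm, hmin⟩

end

section

variable {B W : Type*} [Fintype B] [DecidableEq B] [Group W] {M : CoxeterMatrix B}
variable {cs : CoxeterSystem M W} [Fintype W] (hirr : IsIrreducibleCS cs)
variable {χ : B → Bool} (hχ : IsColoring M χ)
include hirr hχ

open Classical in
/-- Along two full turns, every reflection becomes simple exactly twice. -/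
lemma card_simple_times {t : W} (ht : cs.IsReflection t) :
    ((Finset.range (2 * orderOf (bipartite cs χ))).filter fun k => ∃ s, χ s = (!stepColor k) ∧
      halfPow cs χ k * t * (halfPow cs χ k)⁻¹ = cs.simple s).card = 2 := by
  obtain ⟨v, lam, hv, heig⟩ := exists_positive_eigenvector hirr
  obtain ⟨β, hβ, -⟩ := exists_nonneg_root hirr ht
  obtain ⟨hm0, hm, hmin⟩ := recSol_orderOf_bipartite hirr hχ hv heig
  have hnn := recSol_mul_nonneg hirr hχ hv heig
  set h := orderOf (bipartite cs χ)
  have hrec := isRec_orbitSeq cs hχ heig β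
  have hone (f : ℕ → ℝ) (hf : ∃! k, k < h ∧ f k = 0) :
      ∑ k ∈ Finset.range h, (if f k = 0 then 1 else 0) = 1 := by
    rw [← Finset.card_filter, Finset.card_eq_one]
    obtain ⟨k, hk, huniq⟩ := hf
    refine ⟨k, Finset.ext fun k' => ?_⟩
    simp only [Finset.mem_filter, Finset.mem_range, Finset.mem_singleton]
    exact ⟨fun h' => huniq k' h', fun h' => h' ▸ hk⟩
  simp only [← orbitSeq_eq_zero_iff hirr hχ hv hβ]
  rw [Finset.card_filter, two_mul, Finset.sum_range_add, hone,
    hone fun k => orbitSeq cs χ v β (h + k)]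
  · refine (hrec.shift h).existsUnique_zero (fun k => ?_) (fun k => ?_) hnn hm0 hm hmin
    · exact orbitSeq_ne_zero_or hirr hχ hv hβ (h + k)
    · exact orbitSeq_mul_nonneg hirr hχ hv hβ (h + k)
  · exact hrec.existsUnique_zero (orbitSeq_ne_zero_or hirr hχ hv hβ)
      (orbitSeq_mul_nonneg hirr hχ hv hβ) hnn hm0 hm hmin

omit hirr [Fintype W] [DecidableEq B] in
lemma apply_conj_halfPow {α : Type*} {F : W → α}
    (hF : ∀ t, F (bipartite cs χ * t * (bipartite cs χ)⁻¹) = F t) {k : ℕ} {s : B}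
    (hs : χ s = !stepColor k) :
    F ((halfPow cs χ k)⁻¹ * cs.simple s * halfPow cs χ k) = F (cs.simple s) := by
  have hpow (n : ℕ) (t : W) : F (bipartite cs χ ^ n * t * (bipartite cs χ ^ n)⁻¹) = F t := by
    induction n generalizing t with
    | zero => simp
    | succ n ih =>
      rw [← hF t, ← ih (bipartite cs χ * t * _), pow_succ, mul_inv_rev]
      simp only [mul_assoc]
  obtain ⟨n, ε, hε, rfl⟩ : ∃ n ε, ε < 2 ∧ k = 2 * n + ε :=
    ⟨k / 2, k % 2, Nat.mod_lt _ two_pos, (Nat.div_add_mod k 2).symm⟩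
  rw [stepColor_two_mul_add] at hs
  have hsimple : (halfPow cs χ ε)⁻¹ * cs.simple s * halfPow cs χ ε = cs.simple s := by
    interval_cases ε
    · simp [halfPow]
    · have hs1 : χ s = true := by rw [hs]; rfl
      have hcomm := commute_colorProd cs hχ s
      rw [hs1] at hcomm
      simp only [halfPow, mul_one, stepColor_zero]
      rw [mul_assoc, hcomm.eq, inv_mul_cancel_left]
  rw [halfPow_two_mul_add cs hχ, mul_inv_rev]
  calc _ = F ((((bipartite cs χ)⁻¹ ^ n)⁻¹) *
        ((halfPow cs χ ε)⁻¹ * cs.simple s * halfPow cs χ ε) * (bipartite cs χ)⁻¹ ^ n) := by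
        simp only [mul_assoc]
    _ = F (cs.simple s) := by
        rw [hsimple, inv_pow, inv_inv, hpow]

open Classical in
/-- Summing a function invariant under conjugation by the bipartite Coxeter element over all
reflections. -/
theorem two_mul_sum_reflections {F : W → ℕ}
    (hF : ∀ t, F (bipartite cs χ * t * (bipartite cs χ)⁻¹) = F t) :
    2 * ∑ t with cs.IsReflection t, F t =
      orderOf (bipartite cs χ) * ∑ s, F (cs.simple s) := by
  set h := orderOf (bipartite cs χ) with hh
  have h1 (k : ℕ) : ∑ s with χ s = !stepColor k, F (cs.simple s) =
      ∑ t with cs.IsReflection t, if ∃ s, χ s = (!stepColor k) ∧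
        halfPow cs χ k * t * (halfPow cs χ k)⁻¹ = cs.simple s then F t else 0 := by
    rw [← Finset.sum_filter, Finset.filter_filter]
    refine Finset.sum_bij (fun s _ => (halfPow cs χ k)⁻¹ * cs.simple s * halfPow cs χ k) ?_ ?_ ?_ ?_
    · intro s hs
      simp only [Finset.mem_filter, Finset.mem_univ, true_and] at hs ⊢
      refine ⟨⟨(halfPow cs χ k)⁻¹, s, by rw [inv_inv]⟩, s, hs, ?_⟩
      simp [mul_assoc]
    · intro s _ r _ hsr
      exact simple_injective cs (mul_left_cancel (mul_right_cancel hsr))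
    · intro t ht
      simp only [Finset.mem_filter, Finset.mem_univ, true_and] at ht
      obtain ⟨-, s, hs, hts⟩ := ht
      refine ⟨s, by simpa using hs, ?_⟩
      rw [← hts]
      simp [mul_assoc]
    · intro s hs
      exact (apply_conj_halfPow hχ hF (by simpa using hs)).symm
  have h2 (n : ℕ) : ∑ k ∈ Finset.range (2 * n), ∑ s with χ s = !stepColor k, F (cs.simple s) =
      n * ∑ s, F (cs.simple s) := by
    induction n with
    | zero => simp
    | succ n ih =>
      rw [show 2 * (n + 1) = 2 * n + 1 + 1 by ring, Finset.sum_range_succ,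
        Finset.sum_range_succ, ih, add_assoc, stepColor_succ,
        show stepColor (2 * n) = true from stepColor_two_mul_add n 0, add_mul,
        one_mul, Bool.not_true, Bool.not_false,
        ← Finset.sum_filter_add_sum_filter_not Finset.univ (fun s => χ s = false)
          (fun s => F (cs.simple s))]
      simp
  rw [← h2, Finset.sum_congr rfl fun k _ => h1 k, Finset.sum_comm, Finset.mul_sum]
  refine Finset.sum_congr rfl fun t ht => ?_
  rw [← Finset.sum_filter, Finset.sum_const, card_simple_times hirr hχ (Finset.mem_filter.1 ht).2,
    smul_eq_mul]

end

section

section AbsLength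

variable {G : Type*} [Group G] {S : Set G}

/-- Every element is a product of reflections. -/
def ReflectionGenerated (S : Set G) : Prop :=
  ∀ g : G, ∃ l : List G, (∀ t ∈ l, IsReflectionOf S t) ∧ l.prod = g

lemma reflectionGenerated_of_closure (hS : Subgroup.closure S = ⊤) (hinv : ∀ s ∈ S, s⁻¹ = s) :
    ReflectionGenerated S := by
  intro g
  have hg : g ∈ Subgroup.closure S := hS ▸ Subgroup.mem_top g
  have hrefl (s) (hs : s ∈ S) : IsReflectionOf S s := ⟨1, s, hs, by simp⟩
  induction hg using Subgroup.closure_induction with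
  | mem s hs => exact ⟨[s], by simpa using hrefl s hs, by simp⟩
  | one => exact ⟨[], by simp⟩
  | mul x y _ _ hx hy =>
    obtain ⟨l, hl, rfl⟩ := hx
    obtain ⟨l', hl', rfl⟩ := hy
    refine ⟨l ++ l', fun t ht => ?_, List.prod_append⟩
    exact (List.mem_append.1 ht).elim (hl t) (hl' t)
  | inv x _ hx =>
    obtain ⟨l, hl, rfl⟩ := hx
    refine ⟨(l.map (·⁻¹)).reverse, fun t ht => ?_, (List.prod_inv_reverse l).symm⟩
    simp only [List.mem_reverse, List.mem_map] at ht
    obtain ⟨u, hu, rfl⟩ := ht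
    obtain ⟨g, s, hs, rfl⟩ := hl u hu
    exact ⟨g, s, hs, by rw [mul_inv_rev, mul_inv_rev, hinv s hs, inv_inv, mul_assoc]⟩

lemma absLength_prod_le {l : List G} (hl : ∀ t ∈ l, IsReflectionOf S t) :
    absLength S l.prod ≤ l.length := Nat.sInf_le ⟨l, hl, rfl, rfl⟩

lemma absLength_one : absLength S (1 : G) = 0 :=
  Nat.le_zero.1 (absLength_prod_le (l := []) (by simp))

lemma isReflectionOf_conj {t : G} (ht : IsReflectionOf S t) (g : G) :
    IsReflectionOf S (g * t * g⁻¹) := by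
  obtain ⟨w, s, hs, rfl⟩ := ht
  exact ⟨g * w, s, hs, by simp [mul_assoc]⟩

variable (hS : ReflectionGenerated S)
include hS

lemma ReflectionGenerated.exists_list (w : G) :
    ∃ l : List G, (∀ t ∈ l, IsReflectionOf S t) ∧ l.length = absLength S w ∧ l.prod = w :=
  Nat.sInf_mem (s := {k | ∃ l : List G, (∀ t ∈ l, IsReflectionOf S t) ∧ l.length = k ∧ l.prod = w})
    (by obtain ⟨l, hl, rfl⟩ := hS w; exact ⟨_, l, hl, rfl, rfl⟩)

lemma ReflectionGenerated.absLength_mul_le (u w : G) :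
    absLength S (u * w) ≤ absLength S u + absLength S w := by
  obtain ⟨l, hl, hlen, hu⟩ := hS.exists_list u
  obtain ⟨l', hl', hlen', hw⟩ := hS.exists_list w
  rw [← hlen, ← hlen', ← hu, ← hw, ← List.prod_append, ← List.length_append]
  exact absLength_prod_le fun t ht => (List.mem_append.1 ht).elim (hl t) (hl' t)

lemma ReflectionGenerated.absLength_list_prod_le (l : List G) :
    absLength S l.prod ≤ (l.map (absLength S)).sum := by
  induction l with
  | nil => simp [absLength_one]
  | cons a l ih =>
    rw [List.prod_cons, List.map_cons, List.sum_cons]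
    exact (hS.absLength_mul_le _ _).trans (by omega)

lemma ReflectionGenerated.absLength_conj_le (g w : G) :
    absLength S (g * w * g⁻¹) ≤ absLength S w := by
  obtain ⟨l, hl, hlen, hw⟩ := hS.exists_list w
  have h1 : (l.map (MulAut.conj g)).prod = g * w * g⁻¹ := by
    rw [← hw, ← map_list_prod, MulAut.conj_apply]
  rw [← hlen, ← h1, ← List.length_map (MulAut.conj g)]
  refine absLength_prod_le fun t ht => ?_
  obtain ⟨u, hu, rfl⟩ := List.mem_map.1 ht
  exact isReflectionOf_conj (hl u hu) g

lemma ReflectionGenerated.absLength_conj (g w : G) :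
    absLength S (g * w * g⁻¹) = absLength S w := by
  refine (hS.absLength_conj_le g w).antisymm ?_
  have := hS.absLength_conj_le g⁻¹ (g * w * g⁻¹)
  simpa [mul_assoc] using this

lemma ReflectionGenerated.eq_one_of_absLength_eq_zero {w : G} (hw : absLength S w = 0) :
    w = 1 := by
  obtain ⟨l, -, hlen, rfl⟩ := hS.exists_list w
  rw [hw, List.length_eq_zero_iff] at hlen
  simp [hlen]

lemma ReflectionGenerated.absLength_eq_one_iff (h1 : ∀ s ∈ S, s ≠ 1) {t : G} :
    absLength S t = 1 ↔ IsReflectionOf S t := by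
  constructor
  · intro h
    obtain ⟨l, hl, hlen, rfl⟩ := hS.exists_list t
    rw [h, List.length_eq_one_iff] at hlen
    obtain ⟨u, rfl⟩ := hlen
    simpa using hl
  · intro ht
    have hle := absLength_prod_le (l := [t]) (by simpa using ht)
    rw [List.prod_singleton, List.length_singleton] at hle
    refine hle.antisymm (Nat.one_le_iff_ne_zero.2 fun h0 => ?_)
    obtain ⟨g, s, hs, rfl⟩ := ht
    have := hS.eq_one_of_absLength_eq_zero h0
    exact h1 s hs (conj_eq_one_iff.1 this)

end AbsLength

section FactCount

variable {G : Type*} [Group G] {S : Set G}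

/-- The number of factorizations of `g` with factors of prescribed absolute lengths. -/
noncomputable def factCount (S : Set G) (g : G) {m : ℕ} (j : Fin m → ℕ) : ℕ :=
  Nat.card {w : Fin m → G // (List.ofFn w).prod = g ∧ ∀ i, absLength S (w i) = j i}

lemma partialProd_last {H : Type*} [Monoid H] {m : ℕ} (w : Fin m → H) :
    Fin.partialProd w (Fin.last m) = (List.ofFn w).prod := by
  rw [Fin.partialProd, Fin.val_last, List.take_of_length_le (by simp)]

lemma partialSum_last {m : ℕ} (j : Fin m → ℕ) : Fin.partialSum j (Fin.last m) = ∑ i, j i := by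
  rw [Fin.partialSum, Fin.val_last, List.take_of_length_le (by simp), List.sum_ofFn]

/-- Multichains are determined by their quotients. -/
theorem chainCount_eq_factCount (hS : ReflectionGenerated S) {c : G} {m : ℕ} {j : Fin m → ℕ}
    (hj : ∑ i, j i = absLength S c) : chainCount S c j = factCount S c j := by
  refine Nat.card_congr ⟨fun y => ⟨fun i => (y.1 i.castSucc)⁻¹ * y.1 i.succ, ?_, fun i => ?_⟩,
    fun w => ⟨Fin.partialProd w.1, Fin.partialProd_zero _, ?_, ?_⟩, fun y => ?_, fun w => ?_⟩
  · have h1 := Fin.partialProd_left_inv y.1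
    rw [y.2.1, one_smul] at h1
    rw [← partialProd_last, h1, y.2.2.1]
  · have h1 := y.2.2.2.2.1 i
    have h2 := y.2.2.2.2.2 i
    rw [absLe] at h1
    change absLength S ((y.1 i.castSucc)⁻¹ * y.1 i.succ) = j i
    omega
  · rw [partialProd_last, w.2.1]
  · obtain ⟨w, hw, hlen⟩ := w
    have hstep (i : Fin m) : Fin.partialProd w i.succ = Fin.partialProd w i.castSucc * w i :=
      Fin.partialProd_succ w i
    have hsum (i : Fin m) : Fin.partialSum j i.succ = Fin.partialSum j i.castSucc + j i :=
      Fin.partialSum_succ j i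
    have hlo (i : Fin (m + 1)) : absLength S (Fin.partialProd w i) ≤ Fin.partialSum j i := by
      induction i using Fin.induction with
      | zero => simp [absLength_one]
      | succ i ih =>
        rw [hstep, hsum, ← hlen]
        exact (hS.absLength_mul_le _ _).trans (by omega)
    have hhi (i : Fin (m + 1)) : absLength S ((Fin.partialProd w i)⁻¹ * c) + Fin.partialSum j i ≤
        absLength S c := by
      induction i using Fin.reverseInduction with
      | last => rw [partialProd_last, hw, partialSum_last, hj]; simp [absLength_one]
      | cast i ih =>
        rw [hsum, hstep] at ih
        have h1 := hS.absLength_mul_le (w i) ((Fin.partialProd w i.castSucc * w i)⁻¹ * c)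
        rw [hlen, mul_inv_rev, mul_assoc, mul_inv_cancel_left] at h1
        rw [mul_inv_rev, mul_assoc] at ih
        omega
    have htri (i : Fin (m + 1)) : absLength S c ≤
        absLength S (Fin.partialProd w i) + absLength S ((Fin.partialProd w i)⁻¹ * c) := by
      simpa using hS.absLength_mul_le (Fin.partialProd w i) ((Fin.partialProd w i)⁻¹ * c)
    have heq (i : Fin (m + 1)) : absLength S (Fin.partialProd w i) = Fin.partialSum j i := by
      have := hlo i; have := hhi i; have := htri i; omega
    refine ⟨fun i => ?_, fun i => ?_, fun i => ?_⟩
    · have := heq i; have := hhi i; have := htri i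
      change absLength S (Fin.partialProd w i) + absLength S ((Fin.partialProd w i)⁻¹ * c) = _
      omega
    · rw [absLe, heq, heq, Fin.partialProd_right_inv, hlen, hsum]
    · rw [heq, heq, hsum]
  · have h1 := Fin.partialProd_left_inv y.1
    rw [y.2.1, one_smul] at h1
    exact Subtype.ext h1
  · exact Subtype.ext (funext fun i => Fin.partialProd_right_inv w.1 i)

lemma factCount_conj (hS : ReflectionGenerated S) (g c : G) {m : ℕ} (j : Fin m → ℕ) :
    factCount S (g * c * g⁻¹) j = factCount S c j := by
  refine (Nat.card_congr (Equiv.subtypeEquiv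
    (Equiv.piCongrRight fun _ => (MulAut.conj g).toEquiv) fun w => ?_)).symm
  have h1 : List.ofFn (fun i => MulAut.conj g (w i)) = (List.ofFn w).map (MulAut.conj g) := by
    rw [List.map_ofFn]; rfl
  change _ ↔ (List.ofFn fun i => MulAut.conj g (w i)).prod = g * c * g⁻¹ ∧
    ∀ i, absLength S (g * w i * g⁻¹) = j i
  simp only [hS.absLength_conj]
  rw [h1, ← map_list_prod, ← MulAut.conj_apply, (MulAut.conj g).injective.eq_iff]

lemma factCount_of_isConj (hS : ReflectionGenerated S) {c d : G} (h : IsConj c d) {m : ℕ}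
    (j : Fin m → ℕ) : factCount S c j = factCount S d j := by
  obtain ⟨g, rfl⟩ := isConj_iff.1 h
  exact (factCount_conj hS g c j).symm

lemma exists_prod_ofFn_insertNth {k : ℕ} (i : Fin (k + 1)) (w : Fin k → G) :
    ∃ P Q : G, (List.ofFn w).prod = P * Q ∧
      ∀ x, (List.ofFn (i.insertNth x w : Fin (k + 1) → G)).prod = P * x * Q := by
  induction k with
  | zero =>
    obtain rfl : i = 0 := Fin.eq_zero i
    exact ⟨1, 1, by simp, fun x => by simp [List.ofFn_succ]⟩
  | succ k ih =>
    induction i using Fin.cases with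
    | zero => exact ⟨1, (List.ofFn w).prod, by simp, fun x => by simp [List.ofFn_succ]⟩
    | succ i =>
      obtain ⟨P, Q, h1, h2⟩ := ih i (Fin.tail w)
      refine ⟨w 0 * P, Q, ?_, fun x => ?_⟩
      · rw [List.ofFn_succ, List.prod_cons, mul_assoc, ← h1]; rfl
      · rw [← Fin.cons_self_tail w, Fin.insertNth_succ_cons, List.ofFn_cons, List.prod_cons, h2,
          Fin.cons_zero]
        simp only [mul_assoc]

/-- Splitting off a factor of absolute length one. -/
theorem factCount_eq_sum [Fintype G] (hS : ReflectionGenerated S) (c : G) {k : ℕ}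
    (j : Fin (k + 1) → ℕ) (i : Fin (k + 1)) (hi : j i = 1) :
    factCount S c j =
      ∑ t with absLength S t = 1, factCount S (t⁻¹ * c) (j ∘ i.succAbove) := by
  let X := {w : Fin k → G // absLength S (c * (List.ofFn w).prod⁻¹) = 1 ∧
    ∀ a, absLength S (w a) = j (i.succAbove a)}
  have hX : factCount S c j = Nat.card X := by
    have hconj {P Q x p : G} (h : p = P * Q) (hc : P * x * Q = c) :
        absLength S (c * p⁻¹) = absLength S x := by
      rw [h, ← hc, ← hS.absLength_conj P x]
      congr 1
      group
    refine Nat.card_eq_of_bijective (β := X)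
      (fun w => ⟨i.removeNth w.1, ?_, fun a => w.2.2 (i.succAbove a)⟩) ⟨?_, ?_⟩
    · obtain ⟨P, Q, h1, h2⟩ := exists_prod_ofFn_insertNth i (i.removeNth w.1)
      have h3 := h2 (w.1 i)
      rw [Fin.insertNth_self_removeNth, w.2.1] at h3
      rw [hconj h1 h3.symm, w.2.2, hi]
    · intro w w' h
      have h' : i.removeNth w.1 = i.removeNth w'.1 := congrArg Subtype.val h
      obtain ⟨P, Q, h1, h2⟩ := exists_prod_ofFn_insertNth i (i.removeNth w.1)
      have h3 := h2 (w.1 i)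
      have h4 := h2 (w'.1 i)
      rw [Fin.insertNth_self_removeNth, w.2.1] at h3
      rw [h', Fin.insertNth_self_removeNth, w'.2.1] at h4
      have h5 := mul_left_cancel (mul_right_cancel (h3.symm.trans h4))
      apply Subtype.ext
      rw [← Fin.insertNth_self_removeNth i w.1, ← Fin.insertNth_self_removeNth i w'.1, h', h5]
    · rintro ⟨w, hw, hlen⟩
      obtain ⟨P, Q, h1, h2⟩ := exists_prod_ofFn_insertNth i w
      have h3 : P * (P⁻¹ * c * Q⁻¹) * Q = c := by group
      refine ⟨⟨i.insertNth (P⁻¹ * c * Q⁻¹) w, by rw [h2, h3], fun a => ?_⟩, ?_⟩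
      · induction a using Fin.succAboveCases i with
        | x => rw [Fin.insertNth_apply_same, hi, ← hconj h1 h3, hw]
        | p a => rw [Fin.insertNth_apply_succAbove, hlen]
      · exact Subtype.ext (Fin.removeNth_insertNth (α := fun _ => G) i (P⁻¹ * c * Q⁻¹) w)
  rw [hX]
  let Y (t : {t : G // absLength S t = 1}) := {w : Fin k → G // (List.ofFn w).prod = t.1⁻¹ * c ∧
    ∀ a, absLength S (w a) = (j ∘ i.succAbove) a}
  have e : X ≃ Σ t, Y t :=
    { toFun := fun w => ⟨⟨_, w.2.1⟩, w.1, by simp, w.2.2⟩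
      invFun := fun p => ⟨p.2.1, by rw [p.2.2.1]; simpa using p.1.2, p.2.2.2⟩
      left_inv := fun w => rfl
      right_inv := by
        rintro ⟨⟨t, ht⟩, w, hw, hlen⟩
        have h1 : c * (List.ofFn w).prod⁻¹ = t := by rw [hw]; simp
        subst h1
        rfl }
  rw [Nat.card_congr e, Nat.card_sigma, Finset.sum_subtype (p := fun t => absLength S t = 1)]
  · rfl
  · simp

end FactCount

end

section

lemma exists_map_eq {α β : Type*} {f : α → β} {p : α → Prop} {l : List β}
    (h : ∀ x ∈ l, ∃ a, f a = x ∧ p a) : ∃ l' : List α, l'.map f = l ∧ ∀ a ∈ l', p a := by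
  induction l with
  | nil => exact ⟨[], by simp⟩
  | cons x l ih =>
    obtain ⟨l', rfl, hp⟩ := ih fun y hy => h y (by simp [hy])
    obtain ⟨a, rfl, ha⟩ := h x (by simp)
    exact ⟨a :: l', rfl, by simpa using ⟨ha, hp⟩⟩

section Subgroup

variable {G : Type*} [Group G] {S : Set G} {H : Subgroup G} {S' : Set H}

lemma absLength_coe_le (hS' : ReflectionGenerated S')
    (hsub : ∀ t, IsReflectionOf S' t → IsReflectionOf S (t : G)) (x : H) :
    absLength S (x : G) ≤ absLength S' x := by
  obtain ⟨l, hl, hlen, rfl⟩ := hS'.exists_list x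
  rw [← hlen, ← List.length_map (Subtype.val : H → G), Subgroup.val_list_prod]
  refine absLength_prod_le fun t ht => ?_
  obtain ⟨u, hu, rfl⟩ := List.mem_map.1 ht
  exact hsub u (hl u hu)

/-- If all minimal reflection factorizations of `c` live in a subgroup, factorizations can be
counted there. -/
theorem factCount_coe (hS : ReflectionGenerated S) (hS' : ReflectionGenerated S')
    (hsub : ∀ t, IsReflectionOf S' t → IsReflectionOf S (t : G)) {c : H} {m : ℕ} {j : Fin m → ℕ}
    (hmin : ∑ i, j i ≤ absLength S (c : G))
    (hlift : ∀ L : List G, (∀ t ∈ L, IsReflectionOf S t) → L.prod = c → L.length = ∑ i, j i →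
      ∀ t ∈ L, ∃ t' : H, (t' : G) = t ∧ IsReflectionOf S' t') :
    factCount S' c j = factCount S (c : G) j := by
  have hcoe (w : Fin m → H) :
      (List.ofFn fun i => (w i : G)).prod = ((List.ofFn w).prod : H) := by
    rw [Subgroup.val_list_prod, List.map_ofFn]; rfl
  have hle := absLength_coe_le hS' hsub
  have hdesc {w : Fin m → G} (hw : (List.ofFn w).prod = c) (hlen : ∀ i, absLength S (w i) = j i)
      (i : Fin m) : ∃ x : H, (x : G) = w i ∧ absLength S' x ≤ j i := by
    choose l hl hll hlp using fun i => hS.exists_list (w i)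
    have hmem : ∀ t ∈ l i, ∃ t' : H, (t' : G) = t ∧ IsReflectionOf S' t' := by
      intro t ht
      refine hlift (List.ofFn l).flatten ?_ ?_ ?_ t ?_
      · intro u hu
        obtain ⟨_, hl', hu⟩ := List.mem_flatten.1 hu
        obtain ⟨a, rfl⟩ := (List.mem_ofFn' _ _).1 hl'
        exact hl a u hu
      · rw [List.prod_flatten, List.map_ofFn, ← hw]
        congr 2
        exact funext hlp
      · rw [List.length_flatten, List.map_ofFn, List.sum_ofFn]
        exact Finset.sum_congr rfl fun a _ => (hll a).trans (hlen a)
      · exact List.mem_flatten.2 ⟨l i, (List.mem_ofFn' _ _).2 ⟨i, rfl⟩, ht⟩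
    obtain ⟨l', hl', hp⟩ := exists_map_eq hmem
    refine ⟨l'.prod, ?_, ?_⟩
    · rw [Subgroup.val_list_prod, hl', hlp]
    · rw [← hlen, ← hll, ← hl', List.length_map]
      exact absLength_prod_le hp
  refine Nat.card_eq_of_bijective
    (fun w => ⟨fun i => (w.1 i : G), by rw [hcoe, w.2.1], ?_⟩) ⟨fun w w' h => ?_, ?_⟩
  · have h1 (i : Fin m) : absLength S (w.1 i : G) ≤ j i := (hle _).trans (w.2.2 i).le
    have h2 : ∑ i, j i ≤ ∑ i, absLength S (w.1 i : G) := by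
      refine hmin.trans ?_
      have h0 : (c : G) = (List.ofFn fun i => (w.1 i : G)).prod := by rw [hcoe, w.2.1]
      rw [h0, ← List.sum_ofFn]
      have h3 := hS.absLength_list_prod_le (List.ofFn fun i => (w.1 i : G))
      rwa [List.map_ofFn] at h3
    have h4 := (Finset.sum_eq_sum_iff_of_le fun i _ => h1 i).1
      ((Finset.sum_le_sum fun i _ => h1 i).antisymm h2)
    exact fun i => h4 i (Finset.mem_univ i)
  · exact Subtype.ext (funext fun i => Subtype.ext (congrFun (congrArg Subtype.val h) i))
  · rintro ⟨w, hw, hlen⟩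
    choose x hx hxl using hdesc hw hlen
    obtain rfl : (fun i => (x i : G)) = w := funext hx
    refine ⟨⟨x, Subtype.ext (by rw [← hcoe, hw]), fun i => (hxl i).antisymm ?_⟩, rfl⟩
    rw [← hlen i]
    exact hle _

end Subgroup

section Coxeter

variable {B W : Type*} [Group W] {M : CoxeterMatrix B} (cs : CoxeterSystem M W)

lemma reflectionGenerated_simpleSet : ReflectionGenerated (simpleSet cs) := by
  refine reflectionGenerated_of_closure cs.subgroup_closure_range_simple ?_
  rintro _ ⟨s, rfl⟩
  exact cs.inv_simple s

lemma reflectionGenerated_parabolicGens (s : B) : ReflectionGenerated (parabolicGens cs s) := by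
  refine reflectionGenerated_of_closure (Subgroup.closure_closure_coe_preimage) ?_
  rintro x ⟨⟨r, hr⟩, -⟩
  apply Subtype.ext
  rw [Subgroup.coe_inv, ← hr, cs.inv_simple]

lemma isReflectionOf_simpleSet {t : W} : IsReflectionOf (simpleSet cs) t ↔ cs.IsReflection t := by
  constructor
  · rintro ⟨g, _, ⟨s, rfl⟩, rfl⟩
    exact ⟨g, s, rfl⟩
  · rintro ⟨g, s, rfl⟩
    exact ⟨g, _, ⟨s, rfl⟩, rfl⟩

lemma isReflectionOf_coe_parabolic {s : B} {t : parabolic cs s}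
    (ht : IsReflectionOf (parabolicGens cs s) t) : IsReflectionOf (simpleSet cs) (t : W) := by
  obtain ⟨g, r, hr, rfl⟩ := ht
  exact ⟨g, r, hr.1, rfl⟩

variable [Fintype B] [DecidableEq B]

lemma image_simple_ne (s : B) :
    cs.simple '' {r | r ≠ s} = Set.range cs.simple \ {cs.simple s} := by
  rw [← Set.image_univ, ← Set.image_singleton, ← Set.image_sdiff (simple_injective cs)]
  congr 1
  ext r
  simp

/-- A product of distinct simple reflections is given by a word without repetitions. -/
lemma exists_word {J : Set B} {L : List W} (hL : L.Nodup) (hmem : ∀ x, x ∈ L ↔ x ∈ cs.simple '' J) :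
    ∃ l : List B, l.Nodup ∧ (∀ r, r ∈ l ↔ r ∈ J) ∧ cs.wordProd l = L.prod := by
  obtain ⟨l, rfl, hl⟩ := exists_map_eq (f := cs.simple) (p := (· ∈ J)) fun x hx => by
    obtain ⟨a, ha, rfl⟩ := (hmem x).1 hx
    exact ⟨a, rfl, ha⟩
  refine ⟨l, hL.of_map, fun r => ⟨hl r, fun hr => ?_⟩, rfl⟩
  obtain ⟨a, ha, har⟩ := List.mem_map.1 ((hmem _).2 ⟨r, hr, rfl⟩)
  rwa [← simple_injective cs har]

lemma exists_word_parabolic {s : B} {c : parabolic cs s}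
    (hc : IsCoxeterElementOf (parabolicGens cs s) c) :
    ∃ l : List B, l.Nodup ∧ (∀ r, r ∈ l ↔ r ≠ s) ∧ cs.wordProd l = c := by
  obtain ⟨L, hL, hmem, rfl⟩ := hc
  rw [Subgroup.val_list_prod]
  refine exists_word cs (J := {r | r ≠ s}) (hL.map Subtype.val_injective) fun x => ?_
  rw [image_simple_ne, List.mem_map]
  constructor
  · rintro ⟨y, hy, rfl⟩
    exact (hmem y).1 hy
  · intro hx
    exact ⟨⟨x, Subgroup.subset_closure hx⟩, (hmem _).2 hx, rfl⟩

variable [Fintype W] {cs} (hirr : IsIrreducibleCS cs)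
include hirr

lemma length_le_absLength_wordProd {l : List B} (hl : l.Nodup) :
    l.length ≤ absLength (simpleSet cs) (cs.wordProd l) := by
  obtain ⟨L, hL, hlen, hprod⟩ := (reflectionGenerated_simpleSet cs).exists_list (cs.wordProd l)
  rw [← hlen]
  exact (reflection_factorization hirr l hl L
    (fun t ht => (isReflectionOf_simpleSet cs).1 (hL t ht)) hprod).1

lemma absLength_wordProd {l : List B} (hl : l.Nodup) :
    absLength (simpleSet cs) (cs.wordProd l) = l.length := by
  refine le_antisymm ?_ (length_le_absLength_wordProd hirr hl)
  rw [← List.length_map cs.simple]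
  refine absLength_prod_le fun t ht => ?_
  obtain ⟨r, -, rfl⟩ := List.mem_map.1 ht
  exact ⟨1, _, ⟨r, rfl⟩, by simp⟩

/-- Chains below a parabolic Coxeter element can be counted as factorizations in the full group. -/
theorem chainCount_parabolic {s : B} {c : parabolic cs s}
    (hc : IsCoxeterElementOf (parabolicGens cs s) c) {m : ℕ} {j : Fin m → ℕ}
    (hj : ∑ i, j i + 1 = Fintype.card B) :
    chainCount (parabolicGens cs s) c j = factCount (simpleSet cs) (c : W) j := by
  have hS' := reflectionGenerated_parabolicGens cs s
  obtain ⟨l, hl, hmem, hlc⟩ := exists_word_parabolic cs hc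
  have hlen : l.length = ∑ i, j i := by
    have h1 : l.toFinset = Finset.univ.erase s := by ext r; simp [hmem]
    have h2 := congrArg Finset.card h1
    rw [List.toFinset_card_of_nodup hl, Finset.card_erase_of_mem (Finset.mem_univ s),
      Finset.card_univ] at h2
    omega
  have hmin : ∑ i, j i ≤ absLength (simpleSet cs) (c : W) := by
    rw [← hlen, ← hlc]
    exact length_le_absLength_wordProd hirr hl
  have habs : ∑ i, j i = absLength (parabolicGens cs s) c := by
    refine (hmin.trans
      (absLength_coe_le hS' (fun t => isReflectionOf_coe_parabolic cs) c)).antisymm ?_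
    obtain ⟨l', hl', hp⟩ := exists_map_eq (f := fun x : parabolic cs s => (x : W))
      (p := fun x => x ∈ parabolicGens cs s) (l := l.map cs.simple) fun x hx => by
        obtain ⟨r, hr, rfl⟩ := List.mem_map.1 hx
        have hr' : cs.simple r ∈ Set.range cs.simple \ {cs.simple s} :=
          image_simple_ne cs s ▸ ⟨r, (hmem r).1 hr, rfl⟩
        exact ⟨⟨cs.simple r, Subgroup.subset_closure hr'⟩, rfl, hr'⟩
    have hprod : l'.prod = c := Subtype.ext <| by
      rw [Subgroup.val_list_prod, ← hlc]
      exact congrArg List.prod hl'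
    rw [← hlen, ← hprod, ← List.length_map cs.simple, ← hl', List.length_map]
    exact absLength_prod_le fun t ht => ⟨1, t, hp t ht, by simp⟩
  rw [chainCount_eq_factCount hS' habs, factCount_coe (reflectionGenerated_simpleSet cs) hS'
    (fun t => isReflectionOf_coe_parabolic cs) hmin]
  intro L hL hprod hLlen t ht
  obtain ⟨β, hβ, hsupp⟩ := (reflection_factorization hirr l hl L
    (fun t ht => (isReflectionOf_simpleSet cs).1 (hL t ht)) (hprod.trans hlc.symm)).2
    (hLlen.trans hlen.symm) t ht
  obtain ⟨g, hg, r, hr, rfl⟩ := hβ.exists_conj_of_support hirr (J := {r | r ≠ s})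
    fun r hr => hsupp r (by simpa [hmem] using hr)
  rw [image_simple_ne] at hg
  have hr' : cs.simple r ∈ Set.range cs.simple \ {cs.simple s} :=
    image_simple_ne cs s ▸ ⟨r, hr, rfl⟩
  exact ⟨⟨g, hg⟩ * ⟨cs.simple r, Subgroup.subset_closure hr'⟩ * ⟨g, hg⟩⁻¹, rfl,
    ⟨g, hg⟩, _, hr', rfl⟩

omit hirr [Fintype B] [Fintype W] in
lemma wordProd_eq_simple_mul_erase {χ : B → Bool} (hχ : IsColoring M χ) {s : B} {l : List B}
    (hl : ∀ a ∈ l, χ a = χ s) (hs : s ∈ l) :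
    cs.wordProd l = cs.simple s * cs.wordProd (l.erase s) := by
  induction l with
  | nil => simp at hs
  | cons a l ih =>
    by_cases has : a = s
    · subst has
      rw [List.erase_cons_head, cs.wordProd_cons]
    · have hs' : s ∈ l := (List.mem_cons.1 hs).resolve_left (Ne.symm has)
      rw [List.erase_cons_tail (by simpa using has), cs.wordProd_cons, cs.wordProd_cons,
        ih (fun b hb => hl b (by simp [hb])) hs', ← mul_assoc, ← mul_assoc,
        (commute_of_eq_two cs (hχ a s has (hl a (by simp)))).eq]

omit [Fintype B] [DecidableEq B] hirr [Fintype W] in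
lemma isConj_wordProd_of_perm [DecidableEq B] (hM : IsForestLike M) {l l' : List B} (hl : l.Nodup)
    (hl' : l'.Nodup) (h : ∀ r, r ∈ l ↔ r ∈ l') : IsConj (cs.wordProd l) (cs.wordProd l') :=
  (CoxeterEquiv.of_perm hM hl ((List.perm_ext_iff_of_nodup hl hl').2 h)).isConj cs

omit hirr [Group W] [Fintype W] [DecidableEq B] in
lemma nodup_colorClass_append (χ : B → Bool) :
    (colorClass χ true ++ colorClass χ false).Nodup :=
  (nodup_colorClass χ true).append (nodup_colorClass χ false) fun r hr hr' => by
    rw [mem_colorClass] at hr hr'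
    simp [hr] at hr'

/-- Removing a simple reflection from the bipartite Coxeter element gives a parabolic Coxeter
element. -/
lemma isConj_simple_mul_bipartite {χ : B → Bool} (hχ : IsColoring M χ) {s : B}
    {l : List B} (hl : l.Nodup) (hmem : ∀ r, r ∈ l ↔ r ≠ s) :
    IsConj ((cs.simple s)⁻¹ * bipartite cs χ) (cs.wordProd l) := by
  have hnd := nodup_colorClass_append χ
  have hperm := isConj_wordProd_of_perm (cs := cs) (isForestLike hirr) (hnd.erase s) hl fun r => by
    rw [hnd.mem_erase_iff, hmem, List.mem_append, mem_colorClass, mem_colorClass]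
    cases χ r <;> simp
  refine IsConj.trans ?_ hperm
  have hcomm := commute_colorProd cs hχ s
  have hsplit := wordProd_eq_simple_mul_erase (cs := cs) hχ (s := s) (l := colorClass χ (χ s))
    (fun a ha => mem_colorClass.1 ha) (mem_colorClass.2 rfl)
  change colorProd cs χ (χ s) = _ at hsplit
  cases hs : χ s
  · rw [hs] at hcomm hsplit
    refine isConj_iff.2 ⟨cs.simple s, ?_⟩
    rw [List.erase_append_right _ (by simp [mem_colorClass, hs]), cs.wordProd_append,
      mul_inv_cancel_left, bipartite, mul_assoc, ← (hcomm.inv_left).eq, hsplit,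
      inv_mul_cancel_left]
    rfl
  · rw [hs] at hsplit
    rw [List.erase_append_left _ (by simp [mem_colorClass, hs]), cs.wordProd_append, bipartite,
      hsplit, mul_assoc, inv_mul_cancel_left]
    exact IsConj.refl _

end Coxeter

end

section

lemma orderOf_eq_of_isConj {G : Type*} [Group G] {a b : G} (h : IsConj a b) :
    orderOf a = orderOf b := by
  obtain ⟨g, rfl⟩ := isConj_iff.1 h
  exact ((MulAut.conj g).orderOf_eq a).symm

section Conclusion

variable {B W : Type*} [Fintype B] [DecidableEq B] [Group W] [Fintype W] {M : CoxeterMatrix B}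
  {cs : CoxeterSystem M W}

/-- All Coxeter elements are conjugate to the bipartite one. -/
lemma isConj_bipartite (hirr : IsIrreducibleCS cs) (χ : B → Bool) {l : List B} (hl : l.Nodup)
    (hmem : ∀ r, r ∈ l) : IsConj (cs.wordProd l) (bipartite cs χ) := by
  rw [bipartite, colorProd, colorProd, ← cs.wordProd_append]
  refine isConj_wordProd_of_perm (isForestLike hirr) hl (nodup_colorClass_append χ) fun r => ?_
  cases h : χ r <;> simp [hmem, mem_colorClass, h]

omit [Fintype B] [DecidableEq B] [Fintype W] in
lemma absLength_simpleSet_eq_one_iff {t : W} :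
    absLength (simpleSet cs) t = 1 ↔ cs.IsReflection t := by
  rw [(reflectionGenerated_simpleSet cs).absLength_eq_one_iff, isReflectionOf_simpleSet]
  rintro _ ⟨s, rfl⟩ h
  simpa [h] using cs.length_simple s

theorem two_mul_factCount_bipartite (hirr : IsIrreducibleCS cs) {χ : B → Bool}
    (hχ : IsColoring M χ) {k : ℕ} {j : Fin (k + 1) → ℕ} {i : Fin (k + 1)} (hi : j i = 1) :
    2 * factCount (simpleSet cs) (bipartite cs χ) j = orderOf (bipartite cs χ) *
      ∑ s, factCount (simpleSet cs) ((cs.simple s)⁻¹ * bipartite cs χ) (j ∘ i.succAbove) := by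
  classical
  have hS := reflectionGenerated_simpleSet cs
  rw [factCount_eq_sum hS _ j i hi, ← two_mul_sum_reflections hirr hχ
    (F := fun t => factCount (simpleSet cs) (t⁻¹ * bipartite cs χ) (j ∘ i.succAbove))]
  · congr 1
    refine Finset.sum_congr (Finset.filter_congr fun t _ => ?_) fun _ _ => rfl
    exact absLength_simpleSet_eq_one_iff
  · intro t
    rw [← factCount_conj hS (bipartite cs χ) (t⁻¹ * bipartite cs χ)]
    congr 1
    group

end Conclusion

end

end CoxeterGeometry

open CoxeterGeometry in
/-- **Theorem (chains in the noncrossing partition lattice).**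
If `(W,S)` is a finite irreducible Coxeter system of rank `n` with Coxeter number `h`,
and `(j₁,…,j_{k+1})` is a sequence of nonnegative integers summing to `n` with `j_i = 1`,
then `2·C_{(j₁,…,j_{k+1})}(W) = h · ∑_{s∈S} C_{(j₁,…,ĵᵢ,…,j_{k+1})}(W_⟨s⟩)`. -/
theorem chain_count_recursion
    {B : Type} [Fintype B] {W : Type} [Group W] [Fintype W]
    {M : CoxeterMatrix B} (cs : CoxeterSystem M W)
    (hirr : IsIrreducibleCS cs)
    (c : W) (hc : IsCoxeterElementOf (simpleSet cs) c)
    (h : ℕ) (hh : h = orderOf c)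
    {k : ℕ} (j : Fin (k + 1) → ℕ) (hsum : ∑ t, j t = Fintype.card B)
    (i : Fin (k + 1)) (hji : j i = 1)
    (c' : ∀ s : B, parabolic cs s)
    (hc' : ∀ s : B, IsCoxeterElementOf (parabolicGens cs s) (c' s)) :
    2 * chainCount (simpleSet cs) c j =
      h * ∑ s : B, chainCount (parabolicGens cs s) (c' s) (j ∘ i.succAbove) := by
  classical
  have hS := reflectionGenerated_simpleSet cs
  obtain ⟨χ, hχ⟩ : ∃ χ, IsColoring M χ := exists_coloring (isForestLike hirr)
  obtain ⟨L, hL, hmem, hprod⟩ := hc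
  obtain ⟨l, hl, hlmem, hlc⟩ := exists_word cs (J := Set.univ) hL fun x => by
    rw [hmem, Set.image_univ, simpleSet]
  have hconj : IsConj c (bipartite cs χ) := by
    rw [← hprod, ← hlc]
    exact isConj_bipartite hirr χ hl fun r => (hlmem r).2 trivial
  have hlen : l.length = Fintype.card B := by
    rw [← List.toFinset_card_of_nodup hl, ← Finset.card_univ]
    congr 1
    ext r
    simp [hlmem]
  have habs : ∑ t, j t = absLength (simpleSet cs) c := by
    rw [hsum, ← hprod, ← hlc, absLength_wordProd hirr hl, hlen]
  rw [chainCount_eq_factCount hS habs, factCount_of_isConj hS hconj,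
    two_mul_factCount_bipartite hirr hχ hji, hh, orderOf_eq_of_isConj hconj]
  congr 1
  refine Finset.sum_congr rfl fun s _ => ?_
  obtain ⟨l, hl, hlmem, hlc⟩ := exists_word_parabolic cs (hc' s)
  rw [chainCount_parabolic hirr (hc' s), ← hlc]
  · exact factCount_of_isConj hS (isConj_simple_mul_bipartite hirr hχ hl hlmem) _
  · rw [← hsum, Fin.sum_univ_succAbove _ i, hji, add_comm]
    rfl
end

section
/- Let (W,S) be a finite Coxeter system of rank n with a fixed Coxeter element c. If (j'₁,…,j'_{k+1}) is a permutation of the sequence (j₁,…,j_{k+1}) of nonnegative integers summing to n, then C_{(j'₁,…,j'_{k+1})}(W) = C_{(j₁,…,j_{k+1})}(W). -/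
open scoped BigOperators

section AbsoluteLength

variable {G : Type*} [Group G] {S : Set G}

lemma absLength_prod_le {l : List G} (hl : ∀ t ∈ l, IsReflectionOf S t) :
    absLength S l.prod ≤ l.length :=
  Nat.sInf_le ⟨l, hl, rfl, rfl⟩

@[simp]
lemma absLength_one : absLength S (1 : G) = 0 :=
  Nat.le_zero.mp (absLength_prod_le (l := []) (by simp))

lemma exists_list_length_eq_absLength
    (hS : ∀ w : G, ∃ l : List G, (∀ t ∈ l, IsReflectionOf S t) ∧ l.prod = w) (w : G) :
    ∃ l : List G, (∀ t ∈ l, IsReflectionOf S t) ∧ l.length = absLength S w ∧ l.prod = w :=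
  Nat.sInf_mem (s := {k | ∃ l : List G, (∀ t ∈ l, IsReflectionOf S t) ∧ l.length = k ∧
    l.prod = w}) (by
    obtain ⟨l, hl, hw⟩ := hS w
    exact ⟨l.length, l, hl, rfl, hw⟩)

lemma absLength_mul_le
    (hS : ∀ w : G, ∃ l : List G, (∀ t ∈ l, IsReflectionOf S t) ∧ l.prod = w) (u v : G) :
    absLength S (u * v) ≤ absLength S u + absLength S v := by
  obtain ⟨l, hl, hlu, rfl⟩ := exists_list_length_eq_absLength hS u
  obtain ⟨l', hl', hlv, rfl⟩ := exists_list_length_eq_absLength hS v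
  rw [← hlu, ← hlv, ← List.prod_append, ← List.length_append]
  refine absLength_prod_le fun t ht => ?_
  rcases List.mem_append.mp ht with h | h
  exacts [hl t h, hl' t h]

lemma IsReflectionOf.conj {t : G} (ht : IsReflectionOf S t) (g : G) :
    IsReflectionOf S (g * t * g⁻¹) := by
  obtain ⟨h, s, hs, rfl⟩ := ht
  exact ⟨g * h, s, hs, by group⟩

lemma absLength_conj_le
    (hS : ∀ w : G, ∃ l : List G, (∀ t ∈ l, IsReflectionOf S t) ∧ l.prod = w) (g w : G) :
    absLength S (g * w * g⁻¹) ≤ absLength S w := by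
  obtain ⟨l, hl, hlw, rfl⟩ := exists_list_length_eq_absLength hS w
  rw [← hlw, ← MulAut.conj_apply, map_list_prod, ← List.length_map (MulAut.conj g)]
  refine absLength_prod_le fun t ht => ?_
  obtain ⟨r, hr, rfl⟩ := List.mem_map.mp ht
  exact (hl r hr).conj g

lemma absLength_conj
    (hS : ∀ w : G, ∃ l : List G, (∀ t ∈ l, IsReflectionOf S t) ∧ l.prod = w) (g w : G) :
    absLength S (g * w * g⁻¹) = absLength S w := by
  refine (absLength_conj_le hS g w).antisymm ?_
  have h := absLength_conj_le hS g⁻¹ (g * w * g⁻¹)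
  rwa [show g⁻¹ * (g * w * g⁻¹) * g⁻¹⁻¹ = w by group] at h

/-- Multichains with rank jumps `j` are the partial products of the factorizations of `c` into
factors of absolute lengths `j` adding up to the absolute length of `c`. -/
lemma isMultichain_iff_factorization
    (hS : ∀ w : G, ∃ l : List G, (∀ t ∈ l, IsReflectionOf S t) ∧ l.prod = w)
    {c : G} {m : ℕ} {j : Fin m → ℕ} {y : Fin (m + 1) → G} :
    (y 0 = 1 ∧ y (Fin.last m) = c ∧
      (∀ i, absLe S (y i) c) ∧
      (∀ i : Fin m, absLe S (y i.castSucc) (y i.succ)) ∧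
      (∀ i : Fin m, absLength S (y i.succ) = absLength S (y i.castSucc) + j i)) ↔
    (y 0 = 1 ∧ y (Fin.last m) = c ∧
      (∀ i : Fin m, absLength S ((y i.castSucc)⁻¹ * y i.succ) = j i) ∧
      ∑ i, j i = absLength S c) := by
  have hlast : Fin.partialSum j (Fin.last m) = ∑ i, j i := by
    simp [Fin.partialSum, List.sum_ofFn, List.take_of_length_le]
  constructor
  · rintro ⟨h0, h1, -, hle, hlen⟩
    refine ⟨h0, h1, fun i => ?_, ?_⟩
    · have := hle i
      have := hlen i
      unfold absLe at *
      omega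
    · have key : ∀ i, absLength S (y i) = Fin.partialSum j i := by
        intro i
        induction i using Fin.induction with
        | zero => simp [h0]
        | succ i ih => rw [hlen, ih, Fin.partialSum_succ]
      rw [← hlast, ← key, h1]
  · rintro ⟨h0, h1, hlen, hsum⟩
    have hlower : ∀ i, absLength S (y i) ≤ Fin.partialSum j i := by
      intro i
      induction i using Fin.induction with
      | zero => simp [h0]
      | succ i ih =>
        have h := absLength_mul_le hS (y i.castSucc) ((y i.castSucc)⁻¹ * y i.succ)
        rw [mul_inv_cancel_left, hlen] at h
        rw [Fin.partialSum_succ]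
        omega
    have hupper : ∀ i, absLength S ((y i)⁻¹ * c) + Fin.partialSum j i ≤ absLength S c := by
      intro i
      induction i using Fin.reverseInduction with
      | last => simp [h1, hlast, hsum]
      | cast i ih =>
        have h := absLength_mul_le hS ((y i.castSucc)⁻¹ * y i.succ) ((y i.succ)⁻¹ * c)
        rw [mul_assoc, mul_inv_cancel_left, hlen] at h
        rw [Fin.partialSum_succ] at ih
        omega
    have htri : ∀ i, absLength S c ≤ absLength S (y i) + absLength S ((y i)⁻¹ * c) := by
      intro i
      have h := absLength_mul_le hS (y i) ((y i)⁻¹ * c)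
      rwa [mul_inv_cancel_left] at h
    have hstep : ∀ i : Fin m, absLength S (y i.succ) = absLength S (y i.castSucc) + j i := by
      intro i
      have := hlower i.succ
      have := hupper i.succ
      have := htri i.succ
      have := hlower i.castSucc
      have := hupper i.castSucc
      have := htri i.castSucc
      have := Fin.partialSum_succ j i
      omega
    refine ⟨h0, h1, fun i => ?_, fun i => ?_, hstep⟩
    · have := hlower i
      have := hupper i
      have := htri i
      unfold absLe
      omega
    · rw [absLe, hlen, hstep]

/-- The Hurwitz move at an adjacent pair of factors, in terms of partial products. -/
lemma chainCount_le_swap [Finite G]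
    (hS : ∀ w : G, ∃ l : List G, (∀ t ∈ l, IsReflectionOf S t) ∧ l.prod = w)
    (c : G) {k : ℕ} (j : Fin (k + 1) → ℕ) (i : Fin k) :
    chainCount S c j ≤ chainCount S c (j ∘ Equiv.swap i.castSucc i.succ) := by
  unfold chainCount
  simp only [isMultichain_iff_factorization hS]
  have hab : i.castSucc.castSucc ≠ i.succ.castSucc := by simp [Fin.ext_iff]
  have hdb : i.succ.succ ≠ i.succ.castSucc := by simp [Fin.ext_iff]
  refine Nat.card_le_card_of_injective
    (fun y => ⟨Function.update y.1 i.succ.castSucc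
      (y.1 i.castSucc.castSucc * (y.1 i.succ.castSucc)⁻¹ * y.1 i.succ.succ), ?_⟩) ?_
  · obtain ⟨y, h0, h1, hlen, hsum⟩ := y
    refine ⟨?_, ?_, fun t => ?_, ?_⟩
    · rw [Function.update_of_ne]
      · exact h0
      · simp [Fin.ext_iff]
    · rw [Function.update_of_ne]
      · exact h1
      · simpa [Fin.ext_iff] using i.2.ne'
    · simp only [Function.comp_apply]
      by_cases hti : t = i.castSucc
      · subst hti
        rw [Equiv.swap_apply_left, ← hlen i.succ, Function.update_of_ne hab, Fin.succ_castSucc,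
          Function.update_self]
        congr 1
        group
      · by_cases hts : t = i.succ
        · subst hts
          rw [Equiv.swap_apply_right, ← hlen i.castSucc, Function.update_of_ne hdb,
            Function.update_self, Fin.succ_castSucc,
            ← absLength_conj hS ((y i.castSucc.castSucc)⁻¹ * y i.succ.succ)]
          congr 1
          group
        · rw [Equiv.swap_apply_of_ne_of_ne hti hts, ← hlen t, Function.update_of_ne,
            Function.update_of_ne]
          · rw [← Fin.succ_castSucc]
            exact fun h => hti (Fin.succ_injective _ h)
          · exact fun h => hts (Fin.castSucc_injective _ h)
    · rw [← hsum]
      exact Equiv.sum_comp (Equiv.swap i.castSucc i.succ) j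
  · rintro ⟨y, hy⟩ ⟨z, hz⟩ h
    have h' := Subtype.ext_iff.mp h
    have hne : ∀ t, t ≠ i.succ.castSucc → y t = z t := by
      intro t ht
      have h := congrFun h' t
      dsimp only at h
      rwa [Function.update_of_ne ht, Function.update_of_ne ht] at h
    refine Subtype.ext (funext fun t => ?_)
    by_cases ht : t = i.succ.castSucc
    · subst ht
      simpa [hne _ hab, hne _ hdb] using congrFun h' i.succ.castSucc
    · exact hne t ht

lemma chainCount_swap [Finite G]
    (hS : ∀ w : G, ∃ l : List G, (∀ t ∈ l, IsReflectionOf S t) ∧ l.prod = w)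
    (c : G) {k : ℕ} (j : Fin (k + 1) → ℕ) (i : Fin k) :
    chainCount S c (j ∘ Equiv.swap i.castSucc i.succ) = chainCount S c j := by
  refine le_antisymm ?_ (chainCount_le_swap hS c j i)
  have h := chainCount_le_swap hS c (j ∘ Equiv.swap i.castSucc i.succ) i
  have hj : (j ∘ Equiv.swap i.castSucc i.succ) ∘ Equiv.swap i.castSucc i.succ = j := by
    ext t
    simp
  rwa [hj] at h

lemma chainCount_comp_perm [Finite G]
    (hS : ∀ w : G, ∃ l : List G, (∀ t ∈ l, IsReflectionOf S t) ∧ l.prod = w)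
    (c : G) {k : ℕ} (j : Fin (k + 1) → ℕ) (σ : Equiv.Perm (Fin (k + 1))) :
    chainCount S c (j ∘ σ) = chainCount S c j := by
  have hσ : σ ∈ Submonoid.closure
      (Set.range fun i : Fin k => Equiv.swap i.castSucc i.succ) := by
    rw [Equiv.Perm.mclosure_swap_castSucc_succ]
    trivial
  induction hσ using Submonoid.closure_induction generalizing j with
  | mem σ hσ =>
    obtain ⟨i, rfl⟩ := hσ
    exact chainCount_swap hS c j i
  | one => rfl
  | mul σ τ _ _ ihσ ihτ =>
    rw [Equiv.Perm.coe_mul, ← Function.comp_assoc, ihτ, ihσ]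

end AbsoluteLength

lemma exists_reflection_list_prod_eq {B W : Type*} [Group W] {M : CoxeterMatrix B}
    (cs : CoxeterSystem M W) (w : W) :
    ∃ l : List W, (∀ t ∈ l, IsReflectionOf (simpleSet cs) t) ∧ l.prod = w := by
  obtain ⟨ω, rfl⟩ := cs.wordProd_surjective w
  refine ⟨ω.map cs.simple, fun t ht => ?_, rfl⟩
  obtain ⟨b, -, rfl⟩ := List.mem_map.mp ht
  exact ⟨1, cs.simple b, ⟨b, rfl⟩, by simp⟩

/-- **Proposition (permutation invariance of chain counts).**
If `(j'₁,…,j'_{k+1})` is a permutation of `(j₁,…,j_{k+1})`, a sequence of nonnegative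
integers summing to `n = rank(W)`, then `C_{(j'₁,…,j'_{k+1})}(W) = C_{(j₁,…,j_{k+1})}(W)`. -/
theorem chain_count_permute
    {B : Type} [Fintype B] {W : Type} [Group W] [Fintype W]
    {M : CoxeterMatrix B} (cs : CoxeterSystem M W)
    (c : W) (hc : IsCoxeterElementOf (simpleSet cs) c)
    {k : ℕ} (j j' : Fin (k + 1) → ℕ) (hsum : ∑ t, j t = Fintype.card B)
    (σ : Equiv.Perm (Fin (k + 1))) (hperm : j' = j ∘ σ) :
    chainCount (simpleSet cs) c j' = chainCount (simpleSet cs) c j := by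
  rw [hperm]
  exact chainCount_comp_perm (exists_reflection_list_prod_eq cs) c j σ
end
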